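/- arXiv:1002.3613 — 2 statements merged into one kernel-verified Lean document; each statement's English description precedes it below -/
import Mathlib

section
/- Let m ≥ 2 and n ≥ 2, and let ℝPⁿ denote real projective n-space. For every continuous map f : S^m → ℝPⁿ, the pair (f,f) is loose if and only if it is loose by small deformation. -/
open scoped Manifold Topology

/-- The unit sphere `S^m ⊆ ℝ^{m+1}`, as a topological space. -/
abbrev UnitSphere (m : ℕ) : Type :=
  Metric.sphere (0 : EuclideanSpace ℝ (Fin (m + 1))) 1

/-- A pair `(f₁, f₂)` of continuous maps is *loose* if `f₁` and `f₂` can be deformed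
(by free homotopies) to maps `f₁'`, `f₂'` without any coincidence point. -/
def Loose {X N : Type*} [TopologicalSpace X] [TopologicalSpace N]
    (f₁ f₂ : C(X, N)) : Prop :=
  ∃ f₁' f₂' : C(X, N),
    f₁'.Homotopic f₁ ∧ f₂'.Homotopic f₂ ∧ ∀ x, f₁' x ≠ f₂' x

/-- The pair `(f, f)` is *loose by small deformation* if for every metric on the target
inducing its topology and every `ε > 0` there is a continuous `ε`-approximation `g` of `f`
which is coincidence free with `f`. -/
def LooseBySmallDeformation {X N : Type*} [TopologicalSpace X] [tN : TopologicalSpace N]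
    (f : C(X, N)) : Prop :=
  ∀ D : MetricSpace N, D.toUniformSpace.toTopologicalSpace = tN →
    ∀ ε : ℝ, 0 < ε → ∃ g : C(X, N),
      ∀ x, D.toDist.dist (g x) (f x) < ε ∧ g x ≠ f x

/-- Real projective `n`-space: the quotient of the unit sphere `Sⁿ ⊆ ℝ^{n+1}` by the
antipodal map, with the quotient topology. -/
def RealProjectiveSpace (n : ℕ) : Type :=
  Quot (fun x y : UnitSphere n =>
    (y : EuclideanSpace ℝ (Fin (n + 1))) = -(x : EuclideanSpace ℝ (Fin (n + 1))))

noncomputable instance (n : ℕ) : TopologicalSpace (RealProjectiveSpace n) :=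
  inferInstanceAs (TopologicalSpace (Quot _))

open Topology Metric unitInterval
open scoped RealInnerProductSpace

/-! ### The antipodal double cover -/

namespace RealProjectiveSpace

variable {n : ℕ}

/-- The projection of the sphere onto real projective space. -/
def mk (x : UnitSphere n) : RealProjectiveSpace n := Quot.mk _ x

lemma isQuotientMap_mk : IsQuotientMap (mk : UnitSphere n → RealProjectiveSpace n) :=
  isQuotientMap_quot_mk

lemma mk_neg (x : UnitSphere n) : mk (-x) = mk x :=
  (Quot.sound (r := fun x y : UnitSphere n ↦ (y : EuclideanSpace ℝ (Fin (n + 1))) = -x) rfl).symm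

lemma mk_eq_mk_iff {x y : UnitSphere n} : mk x = mk y ↔ x = y ∨ x = -y := by
  refine ⟨fun h ↦ ?_, ?_⟩
  · induction Quot.eqvGen_exact h with
    | rel a b hab => exact .inr (Subtype.ext (by simp [hab]))
    | refl a => exact .inl rfl
    | symm a b _ ih =>
      rcases ih (Quot.eqvGen_sound ‹_›) with rfl | rfl
      exacts [.inl rfl, .inr (neg_neg _).symm]
    | trans a b c _ _ ih₁ ih₂ =>
      rcases ih₁ (Quot.eqvGen_sound ‹_›) with rfl | rfl <;>
        rcases ih₂ (Quot.eqvGen_sound ‹_›) with rfl | rfl <;> simp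
  · rintro (rfl | rfl)
    exacts [rfl, mk_neg y]

lemma isCoveringMap_mk : IsCoveringMap (mk : UnitSphere n → RealProjectiveSpace n) := by
  have hunit (g : sphere (0 : ℝ) 1) : (g : ℝ) = 1 ∨ (g : ℝ) = -1 := by
    have := mem_sphere_zero_iff_norm.1 g.2
    rw [Real.norm_eq_abs] at this
    exact eq_or_eq_neg_of_abs_eq this
  have : Finite (sphere (0 : ℝ) 1) :=
    ((Set.toFinite {1, -1}).subset fun x hx ↦ hunit ⟨x, hx⟩).to_subtype
  have hfree (g : sphere (0 : ℝ) 1) (x : UnitSphere n) (hg : g • x = x) : g = 1 := by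
    refine Subtype.ext (smul_left_injective ℝ (ne_zero_of_mem_unit_sphere x) ?_)
    exact (congrArg Subtype.val hg).trans (one_smul ℝ x.1).symm
  have := (isCancelSMul_iff_eq_one_of_smul_eq (α := sphere (0 : ℝ) 1) (β := UnitSphere n)).2 hfree
  refine (isQuotientMap_mk.isQuotientCoveringMap_of_properlyDiscontinuousSMul
    (G := sphere (0 : ℝ) 1) fun {x y} ↦ mk_eq_mk_iff.trans ⟨?_, ?_⟩).isCoveringMap
  · rintro (rfl | rfl)
    · exact MulAction.mem_orbit_self x
    · exact ⟨⟨-1, by simp⟩, Subtype.ext (neg_one_smul ℝ _)⟩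
  · rintro ⟨g, rfl⟩
    rcases hunit g with h | h
    · exact .inl (Subtype.ext (by change (g : ℝ) • y.1 = _; simp [h]))
    · exact .inr (Subtype.ext (by change (g : ℝ) • y.1 = _; simp [h]))

/-- The line spanned by a nonzero vector. -/
noncomputable def span (w : {w : EuclideanSpace ℝ (Fin (n + 1)) // w ≠ 0}) :
    RealProjectiveSpace n :=
  mk ⟨‖w.1‖⁻¹ • w.1, by simp [norm_smul, w.2]⟩

lemma continuous_span : Continuous (span (n := n)) := by
  refine isQuotientMap_mk.continuous.comp (Continuous.subtype_mk ?_ _)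
  exact (continuous_subtype_val.norm.inv₀ fun w ↦ norm_ne_zero_iff.2 w.2).smul
    continuous_subtype_val

lemma span_eq_mk_iff {w : {w : EuclideanSpace ℝ (Fin (n + 1)) // w ≠ 0}} {y : UnitSphere n} :
    span w = mk y ↔ ∃ c : ℝ, w.1 = c • (y : EuclideanSpace ℝ (Fin (n + 1))) := by
  obtain ⟨w, hw⟩ := w
  have hw' : ‖w‖ ≠ 0 := norm_ne_zero_iff.2 hw
  rw [span, mk_eq_mk_iff]
  simp only [Subtype.ext_iff, coe_neg_sphere]
  constructor
  · rintro (h | h)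
    · exact ⟨‖w‖, by rw [← h, smul_inv_smul₀ hw']⟩
    · exact ⟨-‖w‖, by rw [neg_smul, ← smul_neg, ← h, smul_inv_smul₀ hw']⟩
  · rintro ⟨c, rfl⟩
    have hc : c ≠ 0 := fun h ↦ hw (by simp [h])
    have hy : ‖(y : EuclideanSpace ℝ (Fin (n + 1)))‖ = 1 := norm_eq_of_mem_sphere y
    simp only [norm_smul, hy, mul_one, smul_smul, Real.norm_eq_abs]
    rcases abs_choice c with h | h <;> rw [h]
    · left; rw [inv_mul_cancel₀ hc, one_smul]
    · right; rw [inv_neg, neg_mul, inv_mul_cancel₀ hc, neg_one_smul]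

/-! ### Lifting maps from spheres to the double cover -/

lemma exists_continuousOn_lift {m : ℕ} (f : C(UnitSphere m, RealProjectiveSpace n))
    (v : UnitSphere m) :
    ∃ F : UnitSphere m → UnitSphere n, ContinuousOn F {v}ᶜ ∧ ∀ x ≠ v, mk (F x) = f x := by
  have hv := norm_eq_of_mem_sphere v
  let s := stereographic hv
  let φ : C((ℝ ∙ (v : EuclideanSpace ℝ (Fin (m + 1))))ᗮ, RealProjectiveSpace n) :=
    ⟨f ∘ s.symm, f.continuous.comp (isOpenEmbedding_stereographic_symm hv).continuous⟩
  obtain ⟨e, he⟩ := isQuotientMap_mk.surjective (φ 0)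
  obtain ⟨F, ⟨-, hF⟩, -⟩ := isCoveringMap_mk.existsUnique_continuousMap_lifts φ 0 e he
  refine ⟨F ∘ s, F.continuous.comp_continuousOn s.continuousOn, fun x hx ↦ ?_⟩
  have : mk (F (s x)) = f (s.symm (s x)) := congrFun hF (s x)
  rwa [s.left_inv (show x ∈ s.source from hx)] at this

lemma isPreconnected_compl_pair_neg {m : ℕ} (hm : 2 ≤ m) (v : UnitSphere m) :
    IsPreconnected ({v}ᶜ ∩ {-v}ᶜ : Set (UnitSphere m)) := by
  have hv := norm_eq_of_mem_sphere v
  have : Fact (Module.finrank ℝ (EuclideanSpace ℝ (Fin (m + 1))) = m + 1) := ⟨by simp⟩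
  have hrank : 1 < Module.rank ℝ (ℝ ∙ (v : EuclideanSpace ℝ (Fin (m + 1))))ᗮ := by
    rw [← Module.finrank_eq_rank, Submodule.finrank_orthogonal_span_singleton (n := m)
      (ne_zero_of_mem_unit_sphere v)]
    exact_mod_cast hm
  have := (isConnected_compl_singleton_of_one_lt_rank hrank 0).isPreconnected.image
    (stereographic hv).symm (isOpenEmbedding_stereographic_symm hv).continuous.continuousOn
  convert this using 1
  rw [Set.image_compl_eq_range_sdiff_image (isOpenEmbedding_stereographic_symm hv).injective,
    range_stereographic_symm hv v.2, Set.image_singleton, ← stereographic_apply_neg v,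
    (stereographic hv).left_inv, Set.sdiff_eq]
  intro h
  exact ne_neg_of_mem_unit_sphere ℝ v h.symm

theorem exists_lift {m : ℕ} (hm : 2 ≤ m) (f : C(UnitSphere m, RealProjectiveSpace n)) :
    ∃ F : C(UnitSphere m, UnitSphere n), ∀ x, mk (F x) = f x := by
  classical
  let v : UnitSphere m := ⟨EuclideanSpace.single 0 1, by simp⟩
  have hvn : -v ≠ v := fun h ↦ ne_neg_of_mem_unit_sphere ℝ v h.symm
  obtain ⟨F, hFc, hF⟩ := exists_continuousOn_lift f v
  obtain ⟨G, hGc, hG⟩ := exists_continuousOn_lift f (-v)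
  have key : ∃ G' : UnitSphere m → UnitSphere n, ContinuousOn G' {-v}ᶜ ∧
      (∀ x ≠ -v, mk (G' x) = f x) ∧ Set.EqOn F G' ({v}ᶜ ∩ {-v}ᶜ) := by
    have hc : ContinuousOn (fun x ↦ ⟪(F x).1, (G x).1⟫) ({v}ᶜ ∩ {-v}ᶜ) :=
      (continuous_subtype_val.comp_continuousOn (hFc.mono Set.inter_subset_left)).inner
        (continuous_subtype_val.comp_continuousOn (hGc.mono Set.inter_subset_right))
    have hsq : Set.EqOn ((fun x ↦ ⟪(F x).1, (G x).1⟫) ^ 2) ((fun _ ↦ 1) ^ 2)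
        ({v}ᶜ ∩ {-v}ᶜ) := by
      intro x hx
      rcases mk_eq_mk_iff.1 ((hF x hx.1).trans (hG x hx.2).symm) with h | h <;> simp [h]
    rcases (isPreconnected_compl_pair_neg hm v).eq_or_eq_neg_of_sq_eq hc continuousOn_const hsq
      (by simp) with h | h
    · refine ⟨G, hGc, hG, fun x hx ↦ ?_⟩
      exact (sphere_ext_iff _ _).2 (h hx)
    · refine ⟨fun x ↦ -G x, hGc.neg, fun x hx ↦ (mk_neg _).trans (hG x hx), fun x hx ↦ ?_⟩
      refine (sphere_ext_iff _ _).2 ?_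
      simpa [neg_eq_iff_eq_neg] using h hx
  obtain ⟨G', hGc', hG', hFG⟩ := key
  refine ⟨⟨fun x ↦ if x = v then G' x else F x, continuous_iff_continuousAt.2 fun x ↦ ?_⟩,
    fun x ↦ ?_⟩
  · by_cases hx : x = v
    · subst hx
      have hU : ({-v}ᶜ : Set (UnitSphere m)) ∈ 𝓝 v :=
        isOpen_compl_singleton.mem_nhds hvn.symm
      refine (hGc'.continuousAt hU).congr ?_
      filter_upwards [hU] with y hy
      split_ifs with hyv
      · rfl
      · exact (hFG ⟨hyv, hy⟩).symm
    · have hU : ({v}ᶜ : Set (UnitSphere m)) ∈ 𝓝 x := isOpen_compl_singleton.mem_nhds hx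
      refine (hFc.continuousAt hU).congr ?_
      filter_upwards [hU] with y hy
      exact (if_neg hy).symm
  · by_cases hx : x = v
    · subst hx
      simpa using hG' v hvn.symm
    · simpa [hx] using hF x hx

end RealProjectiveSpace

/-! ### Nowhere vanishing vector fields along maps into a sphere -/

section TangentField

variable {X E : Type*} [TopologicalSpace X] [NormedAddCommGroup E] [InnerProductSpace ℝ E]

/-- There is a nowhere vanishing tangent vector field of the unit sphere along `f`. -/
def HasTangentField (f : C(X, sphere (0 : E) 1)) : Prop :=
  ∃ v : C(X, E), ∀ x, v x ≠ 0 ∧ ⟪(f x : E), v x⟫ = 0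

lemma hasTangentField_of_ne (f g : C(X, sphere (0 : E) 1))
    (h : ∀ x, g x ≠ f x ∧ g x ≠ -f x) : HasTangentField f := by
  refine ⟨⟨fun x ↦ (g x : E) - ⟪(f x : E), g x⟫ • (f x : E), by fun_prop⟩, fun x ↦ ⟨fun h0 ↦ ?_, ?_⟩⟩
  · have h1 := sub_eq_zero.1 h0
    have h2 := congrArg norm h1
    rw [norm_smul, norm_eq_of_mem_sphere, norm_eq_of_mem_sphere, mul_one, Real.norm_eq_abs] at h2
    rcases eq_or_eq_neg_of_abs_eq h2.symm with h3 | h3 <;> rw [h3] at h1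
    · exact (h x).1 (Subtype.ext (by simpa using h1))
    · exact (h x).2 (Subtype.ext (by simpa using h1))
  · simp [inner_sub_right, inner_smul_right]

variable [CompactSpace X]

lemma HasTangentField.of_dist_lt_one {f g : C(X, sphere (0 : E) 1)} (hf : HasTangentField f)
    (hfg : dist f g < 1) : HasTangentField g := by
  obtain ⟨v, hv⟩ := hf
  refine ⟨⟨fun x ↦ v x - ⟪(g x : E), v x⟫ • (g x : E), by fun_prop⟩, fun x ↦ ⟨fun h0 ↦ ?_, ?_⟩⟩
  · obtain ⟨hvx, hor⟩ := hv x
    have h1 := congrArg norm (sub_eq_zero.1 h0)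
    rw [norm_smul, norm_eq_of_mem_sphere, mul_one, Real.norm_eq_abs] at h1
    have h2 : ⟪(g x : E), v x⟫ = ⟪(g x : E) - f x, v x⟫ := by rw [inner_sub_left, hor, sub_zero]
    have h3 : ‖(g x : E) - f x‖ < 1 := by
      rw [← dist_eq_norm, dist_comm]
      exact (ContinuousMap.dist_apply_le_dist x).trans_lt hfg
    have h4 := abs_real_inner_le_norm ((g x : E) - f x) (v x)
    rw [← h2, ← h1] at h4
    nlinarith [norm_pos_iff.2 hvx]
  · simp [inner_sub_right, inner_smul_right]

lemma HasTangentField.of_homotopy (H : C(I × X, sphere (0 : E) 1)) {f g : C(X, sphere (0 : E) 1)}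
    (h0 : ∀ x, H (0, x) = f x) (h1 : ∀ x, H (1, x) = g x) (hf : HasTangentField f) :
    HasTangentField g := by
  have hloc : IsLocallyConstant fun t : I ↦ HasTangentField (H.curry t) := by
    refine (IsLocallyConstant.iff_eventually_eq _).2 fun t ↦ ?_
    filter_upwards [H.curry.continuous.continuousAt.eventually
      (ball_mem_nhds (H.curry t) one_pos)] with s hs
    exact propext ⟨fun h ↦ h.of_dist_lt_one hs, fun h ↦ h.of_dist_lt_one (mem_ball'.1 hs)⟩
  have := hloc.apply_eq_of_preconnectedSpace 0 1
  have e0 : H.curry 0 = f := ContinuousMap.ext h0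
  have e1 : H.curry 1 = g := ContinuousMap.ext h1
  rw [e0, e1] at this
  exact this ▸ hf

end TangentField

lemma MetricSpace.continuous_dist_of_eq {N : Type*} [tN : TopologicalSpace N] (D : MetricSpace N)
    (h : D.toUniformSpace.toTopologicalSpace = tN) :
    Continuous fun p : N × N ↦ D.toDist.dist p.1 p.2 := by
  subst h
  exact continuous_dist

namespace RealProjectiveSpace

variable {n : ℕ}

theorem looseBySmallDeformation_of_hasTangentField {X : Type*} [TopologicalSpace X]
    [CompactSpace X] (f : C(X, RealProjectiveSpace n)) (F : C(X, UnitSphere n))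
    (hF : ∀ x, mk (F x) = f x) (h : HasTangentField F) : LooseBySmallDeformation f := by
  obtain ⟨v, hv⟩ := h
  intro D hD ε hε
  have hne (t : ℝ) (x : X) : (F x : EuclideanSpace ℝ (Fin (n + 1))) + t • v x ≠ 0 := by
    intro h0
    have := congrArg (fun w ↦ ⟪(F x : EuclideanSpace ℝ (Fin (n + 1))), w⟫) h0
    simp [inner_add_right, inner_smul_right, (hv x).2] at this
  let G : C(ℝ × X, RealProjectiveSpace n) :=
    ⟨fun p ↦ span ⟨(F p.2 : EuclideanSpace ℝ (Fin (n + 1))) + p.1 • v p.2, hne _ _⟩,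
      continuous_span.comp (by fun_prop)⟩
  have hG0 (x : X) : G (0, x) = f x := by
    rw [← hF]
    exact span_eq_mk_iff.2 ⟨1, by simp⟩
  have hcont : Continuous fun p : ℝ × X ↦ D.toDist.dist (G p) (f p.2) :=
    (D.continuous_dist_of_eq hD).comp (by fun_prop : Continuous fun p : ℝ × X ↦ (G p, f p.2))
  have hsmall : ∀ᶠ t : ℝ in 𝓝 0, ∀ x ∈ Set.univ, D.toDist.dist (G (t, x)) (f x) < ε := by
    refine isCompact_univ.eventually_forall_of_forall_eventually fun x _ ↦ ?_
    refine hcont.continuousAt.eventually_lt_const ?_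
    change D.toDist.dist (G (0, x)) (f x) < ε
    rw [hG0]
    exact (D.dist_self _).trans_lt hε
  obtain ⟨t, ht, ht0⟩ :=
    ((hsmall.filter_mono nhdsWithin_le_nhds).and self_mem_nhdsWithin : ∀ᶠ t in 𝓝[≠] (0 : ℝ), _).exists
  refine ⟨⟨fun x ↦ G (t, x), by fun_prop⟩, fun x ↦ ⟨ht x trivial, fun heq ↦ ?_⟩⟩
  rw [← hF] at heq
  obtain ⟨c, hc⟩ := span_eq_mk_iff.1 heq
  have := congrArg (fun w ↦ ⟪v x, w⟫) hc
  have hor : ⟪v x, (F x : EuclideanSpace ℝ (Fin (n + 1)))⟫ = 0 := by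
    rw [real_inner_comm]; exact (hv x).2
  simp [inner_add_right, inner_smul_right, hor, (hv x).1] at this
  exact ht0 this

/-- The orthogonal projection onto a line. -/
noncomputable def toProjection : RealProjectiveSpace n →
    (EuclideanSpace ℝ (Fin (n + 1)) →L[ℝ] EuclideanSpace ℝ (Fin (n + 1))) :=
  Quot.lift (fun x ↦ InnerProductSpace.rankOne ℝ x.1 x.1) fun x y h ↦ by simp [h]

lemma toProjection_mk_apply (x : UnitSphere n) (w : EuclideanSpace ℝ (Fin (n + 1))) :
    toProjection (mk x) w = ⟪(x : EuclideanSpace ℝ (Fin (n + 1))), w⟫ • x.1 := rfl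

lemma isEmbedding_toProjection : IsEmbedding (toProjection (n := n)) := by
  have : CompactSpace (RealProjectiveSpace n) :=
    isQuotientMap_mk.surjective.compactSpace isQuotientMap_mk.continuous
  refine (Continuous.isClosedEmbedding ?_ ?_).isEmbedding
  · refine isQuotientMap_mk.continuous_iff.2 ?_
    change Continuous fun x : UnitSphere n ↦ InnerProductSpace.rankOne ℝ x.1 x.1
    exact ((ContinuousLinearMap.smulRightL ℝ (EuclideanSpace ℝ (Fin (n + 1)))
      (EuclideanSpace ℝ (Fin (n + 1)))).continuous.comp
        ((innerSL ℝ).continuous.comp continuous_subtype_val)).clm_apply continuous_subtype_val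
  · intro a b hab
    obtain ⟨x, rfl⟩ := isQuotientMap_mk.surjective a
    obtain ⟨y, rfl⟩ := isQuotientMap_mk.surjective b
    have h := congrArg (fun T ↦ T x.1) hab
    simp only [toProjection_mk_apply] at h
    rw [real_inner_self_eq_norm_sq, norm_eq_of_mem_sphere] at h
    refine Eq.trans ?_ (span_eq_mk_iff (w := ⟨x.1, ne_zero_of_mem_unit_sphere x⟩).2
      ⟨_, by simpa using h⟩)
    exact (span_eq_mk_iff.2 ⟨1, by simp⟩).symm

lemma inner_ne_zero_of_dist_toProjection_lt_one {x y : UnitSphere n}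
    (h : dist (toProjection (mk x)) (toProjection (mk y)) < 1) :
    ⟪(x : EuclideanSpace ℝ (Fin (n + 1))), y⟫ ≠ 0 := by
  intro h0
  rw [dist_eq_norm] at h
  have h1 := (toProjection (mk x) - toProjection (mk y)).le_opNorm y.1
  rw [sub_apply, toProjection_mk_apply, toProjection_mk_apply, h0,
    real_inner_self_eq_norm_sq, norm_eq_of_mem_sphere] at h1
  simp at h1
  linarith

lemma homotopic_of_inner_ne_zero {X : Type*} [TopologicalSpace X]
    {f g : C(X, RealProjectiveSpace n)} (F G : C(X, UnitSphere n)) (hF : ∀ x, mk (F x) = f x)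
    (hG : ∀ x, mk (G x) = g x) (h : ∀ x, ⟪(F x : EuclideanSpace ℝ (Fin (n + 1))), G x⟫ ≠ 0) :
    f.Homotopic g := by
  let w (p : I × X) : EuclideanSpace ℝ (Fin (n + 1)) :=
    (1 - p.1 : ℝ) • (F p.2).1 + ((p.1 : ℝ) * ⟪(F p.2).1, (G p.2).1⟫) • (G p.2).1
  have hw (p : I × X) : w p ≠ 0 := by
    intro h0
    have h1 := congrArg (fun w ↦ ⟪(F p.2).1, w⟫) h0
    simp only [w, inner_add_right, inner_smul_right, inner_zero_right, real_inner_self_eq_norm_sq,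
      norm_eq_of_mem_sphere] at h1
    have h2 : 0 < ⟪(F p.2).1, (G p.2).1⟫ ^ 2 := sq_pos_of_ne_zero (h p.2)
    have h3 := p.1.2.1
    have h4 := p.1.2.2
    rcases h4.lt_or_eq with h5 | h5
    · nlinarith [mul_nonneg h3 h2.le]
    · rw [h5] at h1
      nlinarith
  refine ⟨⟨⟨fun p ↦ span ⟨w p, hw p⟩, continuous_span.comp ?_⟩, fun x ↦ ?_, fun x ↦ ?_⟩⟩
  · exact Continuous.subtype_mk (by fun_prop) _
  · rw [← hF]
    exact span_eq_mk_iff.2 ⟨1, by simp [w]⟩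
  · rw [← hG]
    exact span_eq_mk_iff.2 ⟨⟪(F x).1, (G x).1⟫, by simp [w]⟩

theorem hasTangentField_of_loose {m : ℕ} (hm : 2 ≤ m) (f : C(UnitSphere m, RealProjectiveSpace n))
    (h : Loose f f) :
    ∃ F : C(UnitSphere m, UnitSphere n), (∀ x, mk (F x) = f x) ∧ HasTangentField F := by
  obtain ⟨f₁, f₂, ⟨H⟩, -, hne⟩ := h
  obtain ⟨F₁, hF₁⟩ := exists_lift hm f₁
  obtain ⟨F₂, hF₂⟩ := exists_lift hm f₂
  have h0 (x) : H.toContinuousMap (0, x) = mk (F₁ x) := by rw [hF₁]; exact H.map_zero_left x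
  let L := isCoveringMap_mk.liftHomotopy H.toContinuousMap F₁ h0
  refine ⟨L.comp ⟨fun x ↦ (1, x), by fun_prop⟩, fun x ↦ ?_, ?_⟩
  · have := congrFun (isCoveringMap_mk.liftHomotopy_lifts H.toContinuousMap F₁ h0) (1, x)
    exact this.trans (H.map_one_left x)
  · refine HasTangentField.of_homotopy L
      (isCoveringMap_mk.liftHomotopy_zero H.toContinuousMap F₁ h0) (fun x ↦ rfl)
      (hasTangentField_of_ne F₁ F₂ fun x ↦ ?_)
    have := hne x
    rw [← hF₁, ← hF₂, ne_comm, Ne, mk_eq_mk_iff, not_or] at this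
    exact this

end RealProjectiveSpace

open RealProjectiveSpace in
/-- For every continuous map `f : S^m → ℝPⁿ` (`m, n ≥ 2`), the pair `(f, f)` is loose
if and only if it is loose by small deformation. -/
theorem statement10 (m n : ℕ) (hm : 2 ≤ m) (hn : 2 ≤ n)
    (f : C(UnitSphere m, RealProjectiveSpace n)) :
    Loose f f ↔ LooseBySmallDeformation f := by
  constructor
  · intro h
    obtain ⟨F, hF, hT⟩ := hasTangentField_of_loose hm f h
    exact looseBySmallDeformation_of_hasTangentField f F hF hT
  · intro h
    obtain ⟨g, hg⟩ := h isEmbedding_toProjection.comapMetricSpace rfl 1 one_pos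
    obtain ⟨F, hF⟩ := exists_lift hm f
    obtain ⟨G, hG⟩ := exists_lift hm g
    refine ⟨g, f, homotopic_of_inner_ne_zero G F hG hF fun x ↦ ?_, .refl f, fun x ↦ (hg x).2⟩
    refine inner_ne_zero_of_dist_toProjection_lt_one ?_
    rw [hG, hF]
    exact (hg x).1
end

section
/- Let n ≥ 2 be even and let f : Sⁿ → Sⁿ be a continuous map. Then the pair (f,f) is loose if and only if f is nullhomotopic (homotopic to a constant map). -/
open scoped Manifold Topology

theorem Polynomial.sum_alternating_choose_eval {R : Type*} [CommRing R] (q : Polynomial R) (m : ℕ)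
    (hq : q.natDegree ≤ m) :
    ∑ k ∈ Finset.range (m + 1), ((-1 : R) ^ (m - k) * (m.choose k : R)) * q.eval (k : R) =
      (m.factorial : R) * q.coeff m := by
  have key : (fwdDiff (1 : R))^[m] q.eval 0 = (m.factorial : R) * q.coeff m := by
    rcases hq.lt_or_eq with h | h
    · rw [Polynomial.fwdDiff_iter_eq_zero_of_degree_lt h,
        Polynomial.coeff_eq_zero_of_natDegree_lt h]
      simp
    · subst h
      rw [Polynomial.fwdDiff_iter_degree_eq_factorial]
      simp [mul_comm]
  rw [← key, fwdDiff_iter_eq_sum_shift]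
  refine Finset.sum_congr rfl fun k _ => ?_
  simp [zsmul_eq_mul]

/-- The top finite difference of `s ↦ det (1 + s • A)` is `m! * det A`. -/
theorem ContinuousLinearMap.sum_alternating_choose_det {E : Type*} [NormedAddCommGroup E]
    [NormedSpace ℝ E] [FiniteDimensional ℝ E] (A : E →L[ℝ] E) :
    ∑ k ∈ Finset.range (Module.finrank ℝ E + 1),
      ((-1 : ℝ) ^ (Module.finrank ℝ E - k) * ((Module.finrank ℝ E).choose k : ℝ)) *
        (1 + (k : ℝ) • A).det = ((Module.finrank ℝ E).factorial : ℝ) * A.det := by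
  let b := Module.finBasis ℝ E
  let M := LinearMap.toMatrix b b (A : E →ₗ[ℝ] E)
  have hdet : ∀ s : ℝ, (1 + s • A).det =
      (Matrix.det ((Polynomial.X : Polynomial ℝ) • M.map Polynomial.C +
        (1 : Matrix _ _ ℝ).map Polynomial.C)).eval s := by
    intro s
    rw [← Polynomial.coe_evalRingHom, RingHom.map_det, ContinuousLinearMap.det,
      ← LinearMap.det_toMatrix b]
    congr 1
    have : ((1 + s • A : E →L[ℝ] E) : E →ₗ[ℝ] E) = 1 + s • (A : E →ₗ[ℝ] E) := rfl
    rw [this, map_add, map_smul, LinearMap.toMatrix_one]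
    ext i j
    simp only [M, Polynomial.coe_evalRingHom, RingHom.mapMatrix_apply, Matrix.map_apply,
      Matrix.add_apply, Matrix.smul_apply, Matrix.one_apply, smul_eq_mul, Polynomial.eval_add,
      Polynomial.eval_mul, Polynomial.eval_X, Polynomial.eval_C]
    split_ifs <;> ring
  have hA : A.det = M.det := by
    rw [ContinuousLinearMap.det, LinearMap.det_toMatrix]
  have h := Polynomial.sum_alternating_choose_eval _ _
    (Polynomial.natDegree_det_X_add_C_le M 1)
  rw [Polynomial.coeff_det_X_add_C_card, ← hA] at h
  simp only [Fintype.card_fin] at h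
  rw [← h]
  exact Finset.sum_congr rfl fun k _ => by rw [hdet]

section NullLagrangian

open MeasureTheory Metric Set

theorem continuous_det_fderiv {E : Type*} [NormedAddCommGroup E] [NormedSpace ℝ E] {w : E → E}
    (hw : ContDiff ℝ 1 w) :
    Continuous fun x => (fderiv ℝ w x).det :=
  ContinuousLinearMap.continuous_det.comp (hw.continuous_fderiv one_ne_zero)

variable {E : Type*} [NormedAddCommGroup E] [NormedSpace ℝ E] [FiniteDimensional ℝ E]

theorem ContinuousLinearMap.det_zero_of_nontrivial [Nontrivial E] : (0 : E →L[ℝ] E).det = 0 := by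
  have : Nonempty (Fin (Module.finrank ℝ E)) := ⟨⟨0, Module.finrank_pos⟩⟩
  exact LinearMap.det_zero' (Module.finBasis ℝ E)

theorem bijective_id_add_smul [Nontrivial E] {w : E → E} {C : NNReal} (hC : LipschitzWith C w)
    {s : ℝ} (hs : |s| * C < 1) :
    Function.Bijective fun x => x + s • w x := by
  have hs' : ‖s‖₊ * C < 1 := by
    rw [← NNReal.coe_lt_coe]; simpa using hs
  have happ : ApproximatesLinearOn (fun x => x + s • w x)
      ((ContinuousLinearEquiv.refl ℝ E : E ≃L[ℝ] E) : E →L[ℝ] E) univ (‖s‖₊ * C) := by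
    intro x _ y _
    have h1 : x + s • w x - (y + s • w y) -
      ((ContinuousLinearEquiv.refl ℝ E : E ≃L[ℝ] E) : E →L[ℝ] E) (x - y) = s • (w x - w y) := by
      simp [smul_sub]; abel
    rw [h1, norm_smul]
    have := hC.norm_sub_le x y
    push_cast
    rw [mul_assoc]
    gcongr
  have hN : ‖s‖₊ * C < ‖((ContinuousLinearEquiv.refl ℝ E).symm : E →L[ℝ] E)‖₊⁻¹ := by
    have : ‖((ContinuousLinearEquiv.refl ℝ E).symm : E →L[ℝ] E)‖₊ = 1 := by
      rw [← NNReal.coe_inj, coe_nnnorm]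
      exact ContinuousLinearMap.norm_id
    rw [this]; simpa using hs'
  exact ⟨injOn_univ.1 (happ.injOn (Or.inr hN)), happ.surjective (Or.inr hN)⟩

variable [MeasurableSpace E] [BorelSpace E] (μ : Measure E) [μ.IsAddHaarMeasure]

theorem setIntegral_det_one_add_smul_fderiv [Nontrivial E] {w : E → E} (hw : ContDiff ℝ 1 w)
    {R : ℝ} (hR : ∀ x, x ∉ ball (0 : E) R → w x = 0) {C : NNReal} (hC : LipschitzWith C w)
    {s : ℝ} (hs : |s| * C < 1) (hpos : ∀ x, 0 < (1 + s • fderiv ℝ w x).det) :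
    ∫ x in ball (0 : E) R, (1 + s • fderiv ℝ w x).det ∂μ = μ.real (ball (0 : E) R) := by
  have hbij := bijective_id_add_smul hC hs
  have himg : (fun x => x + s • w x) '' ball (0 : E) R = ball (0 : E) R := by
    rw [← compl_inj_iff, ← image_compl_eq hbij]
    have : EqOn (fun x => x + s • w x) id (ball (0 : E) R)ᶜ := fun x hx => by simp [hR x hx]
    rw [this.image_eq, image_id]
  have hd : ∀ x ∈ ball (0 : E) R,
      HasFDerivWithinAt (fun x => x + s • w x) (1 + s • fderiv ℝ w x) (ball (0 : E) R) x := by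
    intro x _
    exact ((hasFDerivAt_id x).add
      ((hw.differentiable one_ne_zero x).hasFDerivAt.const_smul s)).hasFDerivWithinAt
  have := integral_image_eq_integral_abs_det_fderiv_smul μ measurableSet_ball hd
    hbij.injective.injOn (fun _ => (1 : ℝ))
  rw [himg] at this
  simp only [abs_of_pos (hpos _), smul_eq_mul, mul_one] at this
  rw [← this]
  simp

/-- The Jacobian determinant of a compactly supported `C¹` vector field has zero integral. -/
theorem integral_det_fderiv_eq_zero [Nontrivial E] {w : E → E} (hw : ContDiff ℝ 1 w)
    (hc : HasCompactSupport w) : ∫ x, (fderiv ℝ w x).det ∂μ = 0 := by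
  obtain ⟨C, hC⟩ := hw.lipschitzWith_of_hasCompactSupport hc one_ne_zero
  obtain ⟨R, hRpos, hR⟩ := hc.isCompact.isBounded.subset_ball_lt 0 0
  have hw0 : ∀ x, x ∉ ball (0 : E) R → w x = 0 := fun x hx =>
    image_eq_zero_of_notMem_tsupport fun h => hx (hR h)
  have hD : ∀ x, ‖fderiv ℝ w x‖ ≤ C := fun x => norm_fderiv_le_of_lipschitz ℝ hC
  obtain ⟨η, hη, hdet⟩ : ∃ η > 0, ∀ A : E →L[ℝ] E, ‖A‖ < η → 0 < (1 + A).det := by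
    have hcont : Continuous fun A : E →L[ℝ] E => (1 + A).det :=
      ContinuousLinearMap.continuous_det.comp (continuous_const.add continuous_id)
    have h1 : (0 : ℝ) < (1 + (0 : E →L[ℝ] E)).det := by
      have : (1 + (0 : E →L[ℝ] E)).det = 1 := by
        rw [add_zero]; exact LinearMap.det_id
      rw [this]; exact one_pos
    obtain ⟨η, hη, h⟩ :=
      Metric.eventually_nhds_iff.1 (hcont.continuousAt.eventually (lt_mem_nhds h1))
    exact ⟨η, hη, fun A hA => h (by simpa using hA)⟩
  set m := Module.finrank ℝ E with hm
  have hmpos : 0 < m := Module.finrank_pos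
  obtain ⟨h, hh0, hh1, hh2⟩ : ∃ h : ℝ, 0 < h ∧ (m * h) * C < 1 ∧ (m * h) * C < η := by
    refine ⟨min 1 η / (2 * m * (C + 1)), by positivity, ?_, ?_⟩
    all_goals
      have hC0 : (0 : ℝ) ≤ C := C.2
      have hm0 : (0 : ℝ) < m := by exact_mod_cast hmpos
      have e : (m : ℝ) * (min 1 η / (2 * m * (C + 1))) * C = min 1 η * (C / (2 * (C + 1))) := by
        field_simp
      have hlt : (C : ℝ) / (2 * (C + 1)) < 1 := by rw [div_lt_one (by positivity)]; linarith
      have hmin : 0 < min 1 η := lt_min one_pos hη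
      rw [e]
    · nlinarith [min_le_left 1 η]
    · nlinarith [min_le_right 1 η]
  have hk : ∀ k ∈ Finset.range (m + 1),
      ∫ x in ball (0 : E) R, (1 + (k : ℝ) • (h • fderiv ℝ w x)).det ∂μ =
        μ.real (ball (0 : E) R) := by
    intro k hk
    have hkm : (k : ℝ) ≤ m := by exact_mod_cast Nat.lt_succ_iff.1 (Finset.mem_range.1 hk)
    have hkC : (k * h) * C ≤ (m * h) * C := by gcongr
    have habs : |k * h| = k * h := abs_of_nonneg (by positivity)
    simp only [smul_smul]
    refine setIntegral_det_one_add_smul_fderiv μ hw hw0 hC (by rw [habs]; linarith) fun x => ?_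
    refine hdet _ ?_
    rw [norm_smul, Real.norm_eq_abs, habs]
    calc k * h * ‖fderiv ℝ w x‖ ≤ k * h * C := by gcongr; exact hD x
      _ < η := by linarith
  have hcontk : ∀ k : ℕ, Continuous fun x => (1 + (k : ℝ) • (h • fderiv ℝ w x)).det := fun k =>
    ContinuousLinearMap.continuous_det.comp
      (continuous_const.add (((hw.continuous_fderiv one_ne_zero).const_smul h).const_smul (k : ℝ)))
  have hint : ∀ g : E → ℝ, Continuous g → IntegrableOn g (ball (0 : E) R) μ := fun g hg =>
    (hg.continuousOn.integrableOn_compact (isCompact_closedBall 0 R)).mono_set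
      ball_subset_closedBall
  have hsum : ∫ x in ball (0 : E) R, (m.factorial : ℝ) * (h • fderiv ℝ w x).det ∂μ = 0 := by
    simp_rw [hm, ← ContinuousLinearMap.sum_alternating_choose_det]
    rw [integral_finsetSum _ fun k _ => ((hint _ (hcontk k)).const_mul _)]
    simp_rw [integral_const_mul]
    rw [Finset.sum_congr rfl fun k hk' => by rw [hk k hk'], ← Finset.sum_mul]
    have h0 := Polynomial.sum_alternating_choose_eval (1 : Polynomial ℝ) m (by simp)
    simp only [Polynomial.eval_one, mul_one, Polynomial.coeff_one, hmpos.ne', if_false,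
      mul_zero] at h0
    rw [h0, zero_mul]
  have hdeth : ∀ x, (h • fderiv ℝ w x).det = h ^ m * (fderiv ℝ w x).det := fun x =>
    LinearMap.det_smul h (fderiv ℝ w x : E →ₗ[ℝ] E)
  simp_rw [hdeth] at hsum
  rw [integral_const_mul, integral_const_mul] at hsum
  have hball : ∫ x in ball (0 : E) R, (fderiv ℝ w x).det ∂μ = 0 := by
    have h1 : (m.factorial : ℝ) ≠ 0 := by positivity
    have h2 : h ^ m ≠ 0 := by positivity
    simpa [h1, h2] using hsum
  rw [← hball]
  refine (setIntegral_eq_integral_of_forall_compl_eq_zero fun x hx => ?_).symm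
  have : fderiv ℝ w x = 0 := by
    by_contra hne
    exact hx (hR (support_fderiv_subset ℝ hne))
  rw [this]
  exact ContinuousLinearMap.det_zero_of_nontrivial

theorem integral_det_fderiv_sub_eq_zero [Nontrivial E] {w₁ w₂ : E → E} (h₁ : ContDiff ℝ 1 w₁)
    (h₂ : ContDiff ℝ 1 w₂) {r : ℝ} (hr : 0 < r) (heq : ∀ x, r < ‖x‖ → w₁ x = w₂ x) :
    ∫ x, ((fderiv ℝ w₁ x).det - (fderiv ℝ w₂ x).det) ∂μ = 0 := by
  let χ : ContDiffBump (0 : E) := ⟨r + 1, r + 2, by linarith, by linarith⟩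
  have hχ : ContDiff ℝ 1 χ := χ.contDiff
  have key : ∀ w : E → E, ContDiff ℝ 1 w →
      ContDiff ℝ 1 (fun x => χ x • w x) ∧ HasCompactSupport fun x => χ x • w x := fun w hw =>
    ⟨hχ.smul hw, χ.hasCompactSupport.smul_right⟩
  have hpt : ∀ x, (fderiv ℝ w₁ x).det - (fderiv ℝ w₂ x).det =
      (fderiv ℝ (fun x => χ x • w₁ x) x).det - (fderiv ℝ (fun x => χ x • w₂ x) x).det := by
    intro x
    rcases lt_or_ge r ‖x‖ with hx | hx
    · have hev : ∀ᶠ y in 𝓝 x, w₁ y = w₂ y :=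
        Filter.mem_of_superset ((isOpen_lt continuous_const continuous_norm).mem_nhds hx) heq
      have e1 : fderiv ℝ w₁ x = fderiv ℝ w₂ x := Filter.EventuallyEq.fderiv_eq hev
      have e2 : fderiv ℝ (fun x => χ x • w₁ x) x = fderiv ℝ (fun x => χ x • w₂ x) x :=
        Filter.EventuallyEq.fderiv_eq (hev.mono fun y hy => by simp only [hy])
      rw [e1, e2, sub_self, sub_self]
    · have hev : ∀ w : E → E, (fun y => χ y • w y) =ᶠ[𝓝 x] w := fun w => by
        have hmem : ball (0 : E) (r + 1) ∈ 𝓝 x := isOpen_ball.mem_nhds (by simp; linarith)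
        filter_upwards [hmem] with y hy
        rw [χ.one_of_mem_closedBall (ball_subset_closedBall hy), one_smul]
      rw [(hev w₁).fderiv_eq, (hev w₂).fderiv_eq]
  simp_rw [hpt]
  have hi : ∀ w : E → E, ContDiff ℝ 1 w →
      Integrable (fun x => (fderiv ℝ (fun x => χ x • w x) x).det) μ := fun w hw => by
    refine (continuous_det_fderiv (key w hw).1).integrable_of_hasCompactSupport ?_
    exact ((key w hw).2.fderiv ℝ).comp_left (g := ContinuousLinearMap.det)
      ContinuousLinearMap.det_zero_of_nontrivial
  rw [integral_sub (hi _ h₁) (hi _ h₂), integral_det_fderiv_eq_zero μ (key _ h₁).1 (key _ h₁).2,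
    integral_det_fderiv_eq_zero μ (key _ h₂).1 (key _ h₂).2, sub_self]

end NullLagrangian

/-- The complement of the origin in a vector space. -/
abbrev Punctured (V : Type*) [Zero V] : Type _ := {v : V // v ≠ 0}

section Obstruction

open MeasureTheory Metric Set

theorem exists_contDiff_clamp (δ : ℝ) :
    ∃ θ φ : ℝ → ℝ, ContDiff ℝ 1 θ ∧ (∀ t, HasDerivAt θ (φ t) t) ∧ (∀ t, 0 ≤ φ t) ∧
      (∀ t, |t| < δ → 0 < φ t) ∧ ∀ t, δ ≤ |t| → φ t = 0 := by
  have hφ : Continuous fun t : ℝ => max 0 (δ - |t|) := by fun_prop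
  have hd : ∀ t, HasDerivAt (fun t => ∫ s in (0 : ℝ)..t, max 0 (δ - |s|)) (max 0 (δ - |t|)) t :=
    fun t => (hφ.integral_hasStrictDerivAt 0 t).hasDerivAt
  refine ⟨_, _, ?_, hd, fun t => le_max_left _ _, fun t ht => ?_, fun t ht => ?_⟩
  · rw [contDiff_one_iff_deriv]
    refine ⟨fun t => (hd t).differentiableAt, ?_⟩
    rwa [funext fun t => (hd t).deriv]
  · exact lt_max_of_lt_right (by linarith)
  · exact max_eq_left (by linarith)

variable {ι : Type*} [Fintype ι]

theorem det_fderiv_coordinatewise_comp {θ φ : ℝ → ℝ} (hθ : ∀ t, HasDerivAt θ (φ t) t)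
    {K : (ι → ℝ) → ι → ℝ} (hK : Differentiable ℝ K) (x : ι → ℝ) :
    (fderiv ℝ (fun y i => θ (K y i)) x).det = (∏ i, φ (K x i)) * (fderiv ℝ K x).det := by
  classical
  let D : (ι → ℝ) →L[ℝ] ι → ℝ :=
    ContinuousLinearMap.pi fun i => φ (K x i) • ContinuousLinearMap.proj i
  have hΘ : HasFDerivAt (fun (v : ι → ℝ) i => θ (v i)) D (K x) := by
    rw [hasFDerivAt_pi]
    intro i
    exact (hθ (K x i)).comp_hasFDerivAt (K x) (hasFDerivAt_apply i (K x))
  have hcomp : HasFDerivAt (fun y i => θ (K y i)) (D.comp (fderiv ℝ K x)) x :=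
    hΘ.comp x (hK x).hasFDerivAt
  have hD : D.det = ∏ i, φ (K x i) := by
    have : (D : (ι → ℝ) →ₗ[ℝ] ι → ℝ) = Matrix.toLin' (Matrix.diagonal fun i => φ (K x i)) := by
      refine LinearMap.ext fun v => funext fun i => ?_
      simp [D, Matrix.toLin'_apply, Matrix.mulVec_diagonal]
    rw [ContinuousLinearMap.det, this, LinearMap.det_toLin', Matrix.det_diagonal]
  rw [hcomp.fderiv, ← hD]
  exact LinearMap.det_comp _ _

theorem exists_interpolation_of_homotopic {F : (ι → ℝ) → ι → ℝ} (hF : ContDiff ℝ 1 F)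
    {f g : C(Punctured (ι → ℝ), Punctured (ι → ℝ))} (hf : ∀ x, (f x : ι → ℝ) = F x)
    (hg : ∀ x, (g x : ι → ℝ) = -F x) (hfg : f.Homotopic g) :
    ∃ (K : (ι → ℝ) → ι → ℝ) (c : ℝ), 0 < c ∧ ContDiff ℝ 1 K ∧ (∀ x, ‖x‖ ≤ 1 → K x = F x) ∧
      (∀ x, 2 ≤ ‖x‖ → K x = -F x) ∧ ∀ x, 1 ≤ ‖x‖ → ‖x‖ ≤ 2 → c ≤ ‖K x‖ := by
  classical
  obtain ⟨H⟩ := hfg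
  let K₀ : (ι → ℝ) → ι → ℝ := fun x =>
    if h : x = 0 then F 0 else H (projIcc 0 1 zero_le_one (3 * ‖x‖ - 4), ⟨x, h⟩)
  have h1 : ∀ x, ‖x‖ ≤ 4 / 3 → K₀ x = F x := by
    intro x hx
    by_cases h : x = 0
    · simp [K₀, h]
    · simp only [K₀, h, dite_false]
      rw [projIcc_of_le_left _ (by linarith)]
      exact (congrArg _ (H.apply_zero _)).trans (hf _)
  have h2 : ∀ x, 5 / 3 ≤ ‖x‖ → K₀ x = -F x := by
    intro x hx
    have h : x ≠ 0 := by rintro rfl; norm_num at hx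
    simp only [K₀, h, dite_false]
    rw [projIcc_of_right_le _ (by linarith)]
    exact (congrArg _ (H.apply_one _)).trans (hg _)
  have h3 : ∀ x, 1 ≤ ‖x‖ → K₀ x ≠ 0 := by
    intro x hx
    have h : x ≠ 0 := by rintro rfl; norm_num at hx
    simp only [K₀, h, dite_false]
    exact (H _).prop
  have hU1 : IsOpen {x : ι → ℝ | ‖x‖ < 4 / 3} := isOpen_lt continuous_norm continuous_const
  have hU2 : IsOpen {x : ι → ℝ | 5 / 3 < ‖x‖} := isOpen_lt continuous_const continuous_norm
  have hcont : Continuous K₀ := by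
    rw [continuous_iff_continuousAt]
    intro x
    by_cases h : x = 0
    · have : K₀ =ᶠ[𝓝 x] F := Filter.mem_of_superset (hU1.mem_nhds (by simp [h])) fun y hy =>
        h1 y (le_of_lt hy)
      exact hF.continuous.continuousAt.congr this.symm
    · have hemb : Topology.IsOpenEmbedding (Subtype.val : Punctured (ι → ℝ) → ι → ℝ) :=
        isOpen_ne.isOpenEmbedding_subtypeVal
      have : ContinuousAt (K₀ ∘ Subtype.val) (⟨x, h⟩ : Punctured (ι → ℝ)) := by
        have e : K₀ ∘ Subtype.val = fun y : Punctured (ι → ℝ) =>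
            (H (projIcc 0 1 zero_le_one (3 * ‖(y : ι → ℝ)‖ - 4), y) : ι → ℝ) := by
          funext y
          simp [K₀, y.2]
        rw [e]
        refine Continuous.continuousAt ?_
        refine continuous_subtype_val.comp (H.continuous.comp (Continuous.prodMk ?_ continuous_id))
        exact continuous_projIcc.comp (by fun_prop)
      exact (hemb.continuousAt_iff (x := ⟨x, h⟩)).1 this
  obtain ⟨c, hc, hcK⟩ : ∃ c, 0 < c ∧ ∀ x ∈ closedBall (0 : ι → ℝ) 2 ∩ {x | 1 ≤ ‖x‖}, c ≤ ‖K₀ x‖ :=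
    ((isCompact_closedBall 0 2).inter_right
      (isClosed_le continuous_const continuous_norm)).exists_forall_le'
      hcont.norm.continuousOn fun x hx => norm_pos_iff.2 (h3 x hx.2)
  have hS : IsClosed ({x : ι → ℝ | ‖x‖ ≤ 1} ∪ {x | 2 ≤ ‖x‖}) :=
    (isClosed_le continuous_norm continuous_const).union
      (isClosed_le continuous_const continuous_norm)
  have hU : ({x : ι → ℝ | ‖x‖ < 4 / 3} ∪ {x | 5 / 3 < ‖x‖}) ∈
      𝓝ˢ ({x : ι → ℝ | ‖x‖ ≤ 1} ∪ {x | 2 ≤ ‖x‖}) := by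
    refine (hU1.union hU2).mem_nhdsSet.2 (union_subset_union ?_ ?_)
    · intro x (hx : ‖x‖ ≤ 1); show ‖x‖ < 4 / 3; linarith
    · intro x (hx : 2 ≤ ‖x‖); show 5 / 3 < ‖x‖; linarith
  have hfU : ContDiffOn ℝ (1 : ℕ∞) K₀ ({x : ι → ℝ | ‖x‖ < 4 / 3} ∪ {x | 5 / 3 < ‖x‖}) := by
    rintro x (hx | hx)
    · have : K₀ =ᶠ[𝓝 x] F := Filter.mem_of_superset (hU1.mem_nhds hx) fun y hy => h1 y (le_of_lt hy)
      exact (hF.contDiffAt.congr_of_eventuallyEq this).contDiffWithinAt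
    · have : K₀ =ᶠ[𝓝 x] fun y => -F y :=
        Filter.mem_of_superset (hU2.mem_nhds hx) fun y hy => h2 y (le_of_lt hy)
      exact (hF.neg.contDiffAt.congr_of_eventuallyEq this).contDiffWithinAt
  obtain ⟨K, hK, hKd, hKS, -⟩ := hcont.exists_contDiff_approx_and_eqOn 1
    (continuous_const (y := c / 2)) (fun _ => half_pos hc) hS hU hfU
  refine ⟨K, c / 2, half_pos hc, hK, fun x hx => ?_, fun x hx => ?_, fun x hx hx' => ?_⟩
  · rw [hKS (Or.inl hx), h1 x (by linarith)]
  · rw [hKS (Or.inr hx), h2 x (by linarith)]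
  · have e1 := hcK x ⟨by simpa using hx', hx⟩
    have e2 := hKd x
    rw [dist_eq_norm] at e2
    have := norm_sub_norm_le (K₀ x) (K x)
    rw [norm_sub_rev] at this
    linarith

/-- In odd dimension, a `C¹` map vanishing at most at the origin whose Jacobian has constant sign
and is nonzero at points with arbitrarily small image is not homotopic to its negative
away from the origin. -/
theorem not_homotopic_neg_of_det_sign (hodd : Odd (Fintype.card ι)) {F : (ι → ℝ) → ι → ℝ}
    (hF : ContDiff ℝ 1 F) {σ : ℝ} (hσ : ∀ x, 0 ≤ σ * (fderiv ℝ F x).det)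
    (hreg : ∀ ρ > 0, ∃ x, ‖x‖ < 1 ∧ ‖F x‖ < ρ ∧ σ * (fderiv ℝ F x).det ≠ 0)
    {f g : C(Punctured (ι → ℝ), Punctured (ι → ℝ))} (hf : ∀ x, (f x : ι → ℝ) = F x)
    (hg : ∀ x, (g x : ι → ℝ) = -F x) : ¬ f.Homotopic g := by
  intro hfg
  have : Nonempty ι := Fintype.card_pos_iff.1 hodd.pos
  obtain ⟨K, c, hc, hK, hK1, hK2, hKc⟩ := exists_interpolation_of_homotopic hF hf hg hfg
  obtain ⟨θ, φ, hθ, hθφ, hφ0, hφpos, hφz⟩ := exists_contDiff_clamp c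
  obtain ⟨N, hN⟩ : ∃ N : (ι → ℝ) → ι → ℝ, N = fun z => -F z := ⟨_, rfl⟩
  have hNx : ∀ z, N z = -F z := fun z => by rw [hN]
  have hNc : ContDiff ℝ 1 N := hN ▸ hF.neg
  have hNd := hNc.differentiable one_ne_zero
  have hFd := hF.differentiable one_ne_zero
  have hKd := hK.differentiable one_ne_zero
  have hW1 : ContDiff ℝ 1 fun y i => θ (K y i) :=
    contDiff_pi.2 fun i => hθ.comp (contDiff_pi.1 hK i)
  have hW2 : ContDiff ℝ 1 fun y i => θ (N y i) :=
    contDiff_pi.2 fun i => hθ.comp (contDiff_pi.1 hNc i)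
  have hint := integral_det_fderiv_sub_eq_zero volume hW1 hW2 (r := 2) two_pos
    fun x hx => by
      show (fun i => θ (K x i)) = fun i => θ (N x i)
      rw [hK2 x hx.le, hNx]
  have hneg : ∀ x, (fderiv ℝ N x).det = -(fderiv ℝ F x).det := by
    intro x
    have e : fderiv ℝ N x = (-1 : ℝ) • fderiv ℝ F x := by
      rw [hN, fderiv_fun_neg]
      exact (neg_one_smul ℝ (fderiv ℝ F x)).symm
    rw [e]
    refine (LinearMap.det_smul (-1 : ℝ) (fderiv ℝ F x : (ι → ℝ) →ₗ[ℝ] ι → ℝ)).trans ?_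
    rw [Module.finrank_fintype_fun_eq_card, hodd.neg_one_pow, neg_one_mul]
  have hprod : ∀ v : ι → ℝ, 0 ≤ ∏ i, φ (v i) := fun v => Finset.prod_nonneg fun i _ => hφ0 _
  set G : (ι → ℝ) → ℝ := fun x => σ * ((fderiv ℝ (fun y i => θ (K y i)) x).det -
    (fderiv ℝ (fun y i => θ (N y i)) x).det) with hG
  have hGe : ∀ x, G x = (∏ i, φ (K x i)) * (σ * (fderiv ℝ K x).det) +
      (∏ i, φ (N x i)) * (σ * (fderiv ℝ F x).det) := by
    intro x
    simp only [hG]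
    rw [det_fderiv_coordinatewise_comp hθφ hKd, det_fderiv_coordinatewise_comp hθφ hNd, hneg]
    ring
  have hin : ∀ x, ‖x‖ < 1 → fderiv ℝ K x = fderiv ℝ F x := fun x hx =>
    Filter.EventuallyEq.fderiv_eq (Filter.mem_of_superset
      ((isOpen_lt continuous_norm continuous_const).mem_nhds hx)
        fun y (hy : ‖y‖ < 1) => hK1 y hy.le)
  have hsecond : ∀ x, 0 ≤ (∏ i, φ (N x i)) * (σ * (fderiv ℝ F x).det) := fun x =>
    mul_nonneg (hprod (N x)) (hσ x)
  have hGout : ∀ x, 2 < ‖x‖ → G x = 0 := by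
    intro x hx
    have e : fderiv ℝ K x = fderiv ℝ N x :=
      Filter.EventuallyEq.fderiv_eq (Filter.mem_of_superset
        ((isOpen_lt continuous_const continuous_norm).mem_nhds hx)
        fun y (hy : 2 < ‖y‖) => (hK2 y hy.le).trans (hNx y).symm)
    rw [hGe, e, hneg, hK2 x hx.le, hNx]
    ring
  have hGnn : ∀ x, 0 ≤ G x := by
    intro x
    rcases lt_or_ge ‖x‖ 1 with hx | hx
    · rw [hGe, hin x hx]
      exact add_nonneg (mul_nonneg (hprod _) (hσ x)) (hsecond x)
    rcases le_or_gt ‖x‖ 2 with hx' | hx'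
    · obtain ⟨i, hi⟩ : ∃ i, c ≤ |K x i| := by
        by_contra! hcon
        exact (hKc x hx hx').not_gt ((pi_norm_lt_iff hc).2 fun i => hcon i)
      rw [hGe, Finset.prod_eq_zero (Finset.mem_univ i) (hφz _ hi), zero_mul, zero_add]
      exact hsecond x
    · exact (hGout x hx').ge
  have hGc : Continuous G :=
    continuous_const.mul ((continuous_det_fderiv hW1).sub (continuous_det_fderiv hW2))
  have hGs : HasCompactSupport G :=
    HasCompactSupport.intro (isCompact_closedBall (0 : ι → ℝ) 2) fun x hx =>
      hGout x (by simpa using hx)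
  have hG0 : ∫ x, G x = 0 := by
    simp only [hG]
    rw [integral_const_mul, hint, mul_zero]
  obtain ⟨x, hx1, hxc, hxd⟩ := hreg c hc
  have hp : 0 < ∏ i, φ (F x i) := Finset.prod_pos fun i _ =>
    hφpos _ ((norm_le_pi_norm (F x) i).trans_lt hxc)
  have h1 : 0 < (∏ i, φ (F x i)) * (σ * (fderiv ℝ F x).det) :=
    mul_pos hp (lt_of_le_of_ne (hσ x) hxd.symm)
  have hGx : G x ≠ 0 := by
    rw [hGe, hin x hx1, hK1 x hx1.le]
    exact (add_pos_of_pos_of_nonneg h1 (hsecond x)).ne'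
  exact (hGc.integral_pos_of_hasCompactSupport_nonneg_nonzero (μ := volume) hGs hGnn hGx).ne' hG0

end Obstruction

section Punctured

open Set unitInterval

variable {X : Type*} [TopologicalSpace X]
variable {V : Type*} [NormedAddCommGroup V]
variable {W : Type*} [NormedAddCommGroup W] [NormedSpace ℝ W]

theorem homotopic_of_segment_ne_zero [NormedSpace ℝ V] {f g : C(X, Punctured V)}
    (h : ∀ x, ∀ a b : ℝ, 0 ≤ a → 0 ≤ b → a + b = 1 → a • (f x : V) + b • (g x : V) ≠ 0) :
    f.Homotopic g :=
  ⟨{ toFun := fun p => ⟨(1 - (p.1 : ℝ)) • (f p.2 : V) + (p.1 : ℝ) • (g p.2 : V),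
        h p.2 _ _ (by linarith [p.1.2.2]) p.1.2.1 (by ring)⟩
     continuous_toFun := by fun_prop
     map_zero_left := fun x => by simp
     map_one_left := fun x => by simp }⟩

theorem homotopic_of_pos_smul [NormedSpace ℝ V] {f g : C(X, Punctured V)}
    (h : ∀ x, ∃ c : ℝ, 0 < c ∧ (g x : V) = c • (f x : V)) : f.Homotopic g := by
  refine homotopic_of_segment_ne_zero fun x a b ha hb hab => ?_
  obtain ⟨c, hc, hx⟩ := h x
  rw [hx, smul_smul, ← add_smul]
  refine smul_ne_zero (ne_of_gt ?_) (f x).2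
  rcases ha.eq_or_lt with rfl | ha
  · have : b = 1 := by linarith
    simpa [this] using hc
  · exact add_pos_of_pos_of_nonneg ha (mul_nonneg hb hc.le)

/-- The map of punctured spaces induced by a continuous map that vanishes at most at the origin. -/
def Punctured.map (F : V → W) (hF : Continuous F) (h : ∀ v, v ≠ 0 → F v ≠ 0) :
    C(Punctured V, Punctured W) where
  toFun v := ⟨F v, h v v.2⟩
  continuous_toFun := by fun_prop

/-- The homeomorphism of punctured spaces induced by a linear equivalence. -/
def Punctured.ofEquiv [NormedSpace ℝ V] (L : V ≃L[ℝ] W) : C(Punctured V, Punctured W) :=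
  Punctured.map L L.continuous fun _ hv => (map_ne_zero_iff L L.injective).2 hv

@[simp] theorem Punctured.coe_map {W : Type*} [NormedAddCommGroup W] (F : V → W)
    (hF : Continuous F) (h : ∀ v, v ≠ 0 → F v ≠ 0)
    (v : Punctured V) : (Punctured.map F hF h v : W) = F v := rfl

@[simp] theorem Punctured.coe_ofEquiv [NormedSpace ℝ V] (L : V ≃L[ℝ] W) (v : Punctured V) :
    (Punctured.ofEquiv L v : W) = L v := rfl

theorem continuous_smul_of_norm_le_one [NormedSpace ℝ V] {ν : X → ℝ} (hν : Continuous ν)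
    {k : X → V} (hk : ContinuousOn k {x | ν x ≠ 0}) (hb : ∀ x, ‖k x‖ ≤ 1) :
    Continuous fun x => ν x • k x := by
  rw [continuous_iff_continuousAt]
  intro x
  by_cases hx : ν x = 0
  · rw [ContinuousAt, hx, zero_smul]
    refine squeeze_zero_norm (a := fun y => |ν y|) (fun y => ?_) ?_
    · rw [norm_smul, Real.norm_eq_abs]
      exact mul_le_of_le_one_right (abs_nonneg _) (hb y)
    · have := (hν.abs).tendsto x
      rwa [hx, abs_zero] at this
  · exact hν.continuousAt.smul
      (hk.continuousAt ((isOpen_ne_fun hν continuous_const).mem_nhds hx))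

/-- A family of maps of punctured spaces can be rescaled so as to extend over the origin. -/
theorem exists_continuous_extension (k : C(X × Punctured V, Punctured W)) :
    ∃ K : X × V → W, Continuous K ∧ (∀ x v, ‖K (x, v)‖ = ‖v‖) ∧
      ∀ x, ∀ v : Punctured V, ∃ c : ℝ, 0 < c ∧ K (x, v) = c • (k (x, v) : W) := by
  classical
  let κ : X × V → W := fun p => if h : p.2 ≠ 0 then
    ‖(k (p.1, ⟨p.2, h⟩) : W)‖⁻¹ • (k (p.1, ⟨p.2, h⟩) : W) else 0
  have hκ : ∀ x, ∀ v : Punctured V, κ (x, v) = ‖(k (x, v) : W)‖⁻¹ • (k (x, v) : W) := by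
    intro x v
    simp [κ, v.2]
  have hκn : ∀ x, ∀ v : Punctured V, ‖κ (x, v)‖ = 1 := by
    intro x v
    rw [hκ, norm_smul, norm_inv, norm_norm, inv_mul_cancel₀ (norm_ne_zero_iff.2 (k (x, v)).2)]
  have hcont : ContinuousOn κ {p | ‖p.2‖ ≠ 0} := by
    rw [continuousOn_iff_continuous_domRestrict]
    have e : {p : X × V | ‖p.2‖ ≠ 0}.domRestrict κ = fun p =>
        ‖(k (p.1.1, ⟨p.1.2, norm_ne_zero_iff.1 p.2⟩) : W)‖⁻¹ •
          (k (p.1.1, ⟨p.1.2, norm_ne_zero_iff.1 p.2⟩) : W) := by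
      funext p
      exact hκ p.1.1 ⟨p.1.2, norm_ne_zero_iff.1 p.2⟩
    rw [e]
    have hk : Continuous fun p : {p : X × V | ‖p.2‖ ≠ 0} =>
        (k (p.1.1, ⟨p.1.2, norm_ne_zero_iff.1 p.2⟩) : W) := by fun_prop
    exact (hk.norm.inv₀ fun p => norm_ne_zero_iff.2 (k _).2).smul hk
  refine ⟨fun p => ‖p.2‖ • κ p, continuous_smul_of_norm_le_one (by fun_prop) hcont ?_, ?_, ?_⟩
  · rintro ⟨x, v⟩
    by_cases h : v = 0
    · simp [κ, h]
    · exact (hκn x ⟨v, h⟩).le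
  · intro x v
    by_cases h : v = 0
    · simp [h]
    · rw [norm_smul, norm_norm, hκn x ⟨v, h⟩, mul_one]
  · intro x v
    have h1 : 0 < ‖(v : V)‖ := norm_pos_iff.2 v.2
    have h2 : 0 < ‖(k (x, v) : W)‖ := norm_pos_iff.2 (k (x, v)).2
    exact ⟨‖(v : V)‖ * ‖(k (x, v) : W)‖⁻¹, by positivity, by
      show ‖(v : V)‖ • κ (x, (v : V)) = _
      rw [hκ, smul_smul]⟩

theorem homotopic_of_snd_eq {f g : C(Punctured (V × ℝ), Punctured (W × ℝ))}
    (hf : ∀ x, (f x : W × ℝ).2 = (x : V × ℝ).2) (hg : ∀ x, (g x : W × ℝ).2 = (x : V × ℝ).2)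
    (h : ∀ x : Punctured (V × ℝ), (x : V × ℝ).2 = 0 →
      ∃ c : ℝ, 0 < c ∧ (g x : W × ℝ).1 = c • (f x : W × ℝ).1) :
    f.Homotopic g := by
  refine homotopic_of_segment_ne_zero fun x a b ha hb hab h0 => ?_
  have e2 := congrArg Prod.snd h0
  have e1 := congrArg Prod.fst h0
  simp only [Prod.snd_add, Prod.smul_snd, Prod.fst_add, Prod.smul_fst, hf, hg, Prod.snd_zero,
    Prod.fst_zero, smul_eq_mul, ← add_mul, hab, one_mul] at e1 e2
  obtain ⟨c, hc, hx⟩ := h x e2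
  rw [hx, smul_smul, ← add_smul] at e1
  have hpos : 0 < a + b * c := by
    rcases ha.eq_or_lt with rfl | ha
    · have : b = 1 := by linarith
      simpa [this] using hc
    · exact add_pos_of_pos_of_nonneg ha (mul_nonneg hb hc.le)
  have : (f x : W × ℝ).1 = 0 := (smul_eq_zero.1 e1).resolve_left hpos.ne'
  exact (f x).2 (Prod.ext this ((hf x).trans e2))

/-- A map that sends the open upper and lower half spaces off the opposite poles, and the equator
off both poles, is homotopic to the suspension of its restriction to the equator. -/
theorem homotopic_suspension {f : C(Punctured (V × ℝ), Punctured (W × ℝ))}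
    (hf : ∀ x, (f x : W × ℝ).1 = 0 → 0 < (x : V × ℝ).2 * (f x : W × ℝ).2)
    {g : C(Punctured V, Punctured W)}
    (hg : ∀ (v : Punctured V) (x : Punctured (V × ℝ)), (x : V × ℝ) = ((v : V), (0 : ℝ)) →
      (g v : W) = (f x : W × ℝ).1)
    {G : V → W} (hG : Continuous G) (hG0 : ∀ v, v ≠ 0 → G v ≠ 0)
    (hgG : g.Homotopic (Punctured.map G hG hG0))
    {F : C(Punctured (V × ℝ), Punctured (W × ℝ))}
    (hF : ∀ x, (F x : W × ℝ) = (G (x : V × ℝ).1, (x : V × ℝ).2)) :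
    f.Homotopic F := by
  obtain ⟨H⟩ := hgG
  obtain ⟨K, hK, hKn, hKc⟩ :=
    exists_continuous_extension (X := I) (V := V) (W := W) H.toContinuousMap
  have hne : ∀ x : Punctured (V × ℝ), (x : V × ℝ).2 = 0 → (x : V × ℝ).1 ≠ 0 := fun x h0 h1 =>
    x.2 (Prod.ext h1 h0)
  let f₁ : C(Punctured (V × ℝ), Punctured (W × ℝ)) :=
    ⟨fun x => ⟨((f x : W × ℝ).1, (x : V × ℝ).2), fun h => by
      have := hf x (congrArg Prod.fst h)
      rw [show (x : V × ℝ).2 = 0 from congrArg Prod.snd h, zero_mul] at this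
      exact lt_irrefl _ this⟩, by fun_prop⟩
  let k : I → C(Punctured (V × ℝ), Punctured (W × ℝ)) := fun s =>
    ⟨fun x => ⟨(K (s, (x : V × ℝ).1), (x : V × ℝ).2), fun h => hne x (congrArg Prod.snd h) <| by
      rw [← norm_eq_zero, ← hKn s, show K (s, (x : V × ℝ).1) = 0 from congrArg Prod.fst h,
        norm_zero]⟩, by fun_prop⟩
  have h1 : f.Homotopic f₁ := by
    refine homotopic_of_segment_ne_zero fun x a b ha hb hab h0 => ?_
    have e2 := congrArg Prod.snd h0
    have e1 := congrArg Prod.fst h0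
    simp only [f₁, ContinuousMap.coe_mk, Prod.snd_add, Prod.smul_snd, Prod.fst_add, Prod.smul_fst,
      Prod.snd_zero, Prod.fst_zero, smul_eq_mul, ← add_smul, hab, one_smul] at e1 e2
    have := hf x e1
    rcases ha.eq_or_lt with rfl | ha
    · have : (x : V × ℝ).2 = 0 := by
        have hb1 : b = 1 := by linarith
        simpa [hb1] using e2
      simp [this] at *
    · have e3 := congrArg (· * (x : V × ℝ).2) e2
      simp only [zero_mul] at e3
      nlinarith [mul_pos ha this, mul_nonneg hb (sq_nonneg (x : V × ℝ).2)]
  have h2 : f₁.Homotopic (k 0) := by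
    refine homotopic_of_snd_eq (fun x => rfl) (fun x => rfl) fun x hx => ?_
    obtain ⟨c, hc, e⟩ := hKc 0 ⟨(x : V × ℝ).1, hne x hx⟩
    refine ⟨c, hc, e.trans ?_⟩
    have : (H (0, ⟨(x : V × ℝ).1, hne x hx⟩) : W) = (f x : W × ℝ).1 := by
      rw [H.apply_zero]
      exact hg _ x (Prod.ext rfl hx)
    exact congrArg (c • ·) this
  have h3 : (k 0).Homotopic (k 1) :=
    ⟨{ toFun := fun p => k p.1 p.2
       continuous_toFun := by
        refine Continuous.subtype_mk (Continuous.prodMk (hK.comp ?_) ?_) _ <;> fun_prop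
       map_zero_left := fun x => rfl
       map_one_left := fun x => rfl }⟩
  have h4 : (k 1).Homotopic F := by
    refine ContinuousMap.Homotopic.symm ?_
    refine homotopic_of_snd_eq (fun x => by rw [hF]) (fun x => rfl) fun x hx => ?_
    obtain ⟨c, hc, e⟩ := hKc 1 ⟨(x : V × ℝ).1, hne x hx⟩
    refine ⟨c, hc, e.trans ?_⟩
    have : (H (1, ⟨(x : V × ℝ).1, hne x hx⟩) : W) = (F x : W × ℝ).1 := by
      rw [H.apply_one, hF]
      rfl
    exact congrArg (c • ·) this
  exact ((h1.trans h2).trans h3).trans h4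

end Punctured

section Plane

open Complex

/-- Every self-map of the punctured plane is homotopic to a power of the coordinate. -/
theorem exists_homotopic_zpow (f : C(Punctured ℂ, Punctured ℂ)) :
    ∃ d : ℤ, ∃ g : C(Punctured ℂ, Punctured ℂ), (∀ z, (g z : ℂ) = (z : ℂ) ^ d) ∧ f.Homotopic g := by
  let q : C(ℂ, Punctured ℂ) := ⟨fun z => ⟨exp z, exp_ne_zero z⟩, by fun_prop⟩
  have hq : IsCoveringMap q := isCoveringMap_exp
  have hqq : Topology.IsQuotientMap q := isAddQuotientCoveringMap_exp.toIsQuotientMap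
  obtain ⟨e₀, he₀⟩ := hqq.surjective (f (q 0))
  obtain ⟨ℓ, ⟨-, hℓ⟩, -⟩ := hq.existsUnique_continuousMap_lifts (f.comp q) 0 e₀ he₀
  have hexp : ∀ z, exp (ℓ z) = f (q z) := fun z => congrArg Subtype.val (congrFun hℓ z)
  have hper : ∀ z, ∃ n : ℤ, ℓ (z + 2 * Real.pi * I) = ℓ z + n * (2 * Real.pi * I) := by
    intro z
    rw [← exp_eq_exp_iff_exists_int, hexp, hexp]
    congr 2
    exact Subtype.ext (exp_periodic z)
  choose n hn using hper
  have hpi : (2 * Real.pi * I : ℂ) ≠ 0 := by simp [Real.pi_ne_zero]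
  have hnc : Continuous n := by
    have : Continuous fun z => ((n z : ℤ) : ℂ) := by
      have e : (fun z => ((n z : ℤ) : ℂ)) =
          fun z => (ℓ (z + 2 * Real.pi * I) - ℓ z) / (2 * Real.pi * I) := by
        funext z
        rw [hn, add_sub_cancel_left, mul_div_cancel_right₀ _ hpi]
      rw [e]
      fun_prop
    exact isometry_intCast.comp_continuous_iff.1 this
  obtain ⟨d, hd⟩ : ∃ d, ∀ z, n z = d := ⟨n 0, fun z =>
    PreconnectedSpace.constant inferInstance hnc⟩
  have hm : ∀ (m : ℤ) z, ℓ (z + m * (2 * Real.pi * I)) = ℓ z + d * (m * (2 * Real.pi * I)) := by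
    intro m
    induction m using Int.induction_on with
    | zero => simp
    | succ i ih =>
      intro z
      have := hn (z + i * (2 * Real.pi * I))
      rw [hd] at this
      have e := ih z
      push_cast at e ⊢
      rw [show z + (i + 1) * (2 * Real.pi * I) =
          z + i * (2 * Real.pi * I) + 2 * Real.pi * I by ring,
        this, e]
      ring
    | pred i ih =>
      intro z
      have := hn (z + (-i - 1) * (2 * Real.pi * I))
      rw [hd] at this
      have e := ih z
      push_cast at e ⊢
      rw [show z + (-i - 1) * (2 * Real.pi * I) + 2 * Real.pi * I =
          z + -i * (2 * Real.pi * I) by ring,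
        e] at this
      linear_combination -this
  let κ : Punctured ℂ → ℂ := fun z => ℓ (log z) - d * log z
  have hκ : ∀ z, κ (q z) = ℓ z - d * z := by
    intro z
    obtain ⟨m, hm'⟩ := exp_eq_exp_iff_exists_int.1 (exp_log (exp_ne_zero z))
    show ℓ (log (exp z)) - d * log (exp z) = _
    rw [hm', hm]
    ring
  have hκc : Continuous κ := by
    rw [hqq.continuous_iff]
    have : κ ∘ q = fun z => ℓ z - d * z := funext hκ
    rw [this]
    fun_prop
  have hf : ∀ z, (f z : ℂ) = (z : ℂ) ^ d * exp (κ z) := by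
    intro z
    obtain ⟨w, rfl⟩ := hqq.surjective z
    rw [← hexp, hκ]
    show _ = exp w ^ d * _
    rw [← exp_int_mul, ← exp_add]
    congr 1
    ring
  have hz : Continuous fun z : Punctured ℂ => (z : ℂ) ^ d :=
    continuous_subtype_val.zpow₀ d fun z => Or.inl z.2
  refine ⟨d, ⟨fun z => ⟨(z : ℂ) ^ d, zpow_ne_zero _ z.2⟩, hz.subtype_mk _⟩, fun z => rfl, ⟨?_⟩⟩
  exact
    { toFun := fun p => ⟨(p.2 : ℂ) ^ d * exp ((1 - (p.1 : ℝ) : ℝ) * κ p.2),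
        mul_ne_zero (zpow_ne_zero _ p.2.2) (exp_ne_zero _)⟩
      continuous_toFun := by
        refine Continuous.subtype_mk ((hz.comp continuous_snd).mul ?_) _
        fun_prop
      map_zero_left := fun x => Subtype.ext (by simp [hf])
      map_one_left := fun x => Subtype.ext (by simp) }

theorem exists_homotopic_pow (f : C(Punctured ℂ, Punctured ℂ)) :
    ∃ (d : ℕ) (c : ℂ ≃L[ℝ] ℂ), ∃ g : C(Punctured ℂ, Punctured ℂ),
      (∀ z, (g z : ℂ) = c z ^ d) ∧ f.Homotopic g := by
  obtain ⟨d, g, hg, hfg⟩ := exists_homotopic_zpow f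
  obtain ⟨d, rfl | rfl⟩ := d.eq_nat_or_neg
  · exact ⟨d, ContinuousLinearEquiv.refl ℝ ℂ, g, fun z => by simp [hg], hfg⟩
  · let g' : C(Punctured ℂ, Punctured ℂ) :=
      Punctured.map (fun z => conjCLE z ^ d) (by fun_prop)
        fun z hz => pow_ne_zero _ (by simpa using hz)
    refine ⟨d, conjCLE, g', fun z => rfl, hfg.trans (homotopic_of_pos_smul fun z => ?_)⟩
    have hz : 0 < normSq z := normSq_pos.2 z.2
    refine ⟨normSq z ^ d, by positivity, ?_⟩
    rw [hg, real_smul, zpow_neg, zpow_natCast]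
    push_cast
    rw [normSq_eq_conj_mul_self, mul_pow, mul_assoc, mul_inv_cancel₀ (pow_ne_zero _ z.2), mul_one]
    rfl

end Plane

section NormalForm

variable {V : Type*} [NormedAddCommGroup V] [NormedSpace ℝ V]
variable {W : Type*} [NormedAddCommGroup W] [NormedSpace ℝ W]
variable {V' : Type*} [NormedAddCommGroup V'] [NormedSpace ℝ V']
variable {W' : Type*} [NormedAddCommGroup W'] [NormedSpace ℝ W']

/-- The iterated suspension of the `d`-th power map of the plane. -/
def suspendedPow (d k : ℕ) (p : ℂ × (Fin k → ℝ)) : ℂ × (Fin k → ℝ) := (p.1 ^ d, p.2)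

theorem continuous_suspendedPow (d k : ℕ) : Continuous (suspendedPow d k) := by
  unfold suspendedPow
  fun_prop

theorem suspendedPow_ne_zero (d k : ℕ) {p : ℂ × (Fin k → ℝ)} (hp : p ≠ 0) :
    suspendedPow d k p ≠ 0 := fun h =>
  hp (Prod.ext (eq_zero_of_pow_eq_zero (congrArg Prod.fst h))
    (show p.2 = 0 from congrArg Prod.snd h))

/-- A map of punctured spaces is of power type if, up to homotopy and in suitable linear
coordinates, it is a suspended power map. -/
def IsPowerType (k : ℕ) (f : C(Punctured V, Punctured W)) : Prop :=
  ∃ (d : ℕ) (L : V ≃L[ℝ] ℂ × (Fin k → ℝ)) (L' : (ℂ × (Fin k → ℝ)) ≃L[ℝ] W)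
    (g : C(Punctured V, Punctured W)),
    (∀ x, (g x : W) = L' (suspendedPow d k (L x))) ∧ f.Homotopic g

theorem IsPowerType.of_homotopic {k : ℕ} {f g : C(Punctured V, Punctured W)} (hg : IsPowerType k g)
    (h : f.Homotopic g) : IsPowerType k f := by
  obtain ⟨d, L, L', g', hg', hgg'⟩ := hg
  exact ⟨d, L, L', g', hg', h.trans hgg'⟩

theorem ContinuousMap.Homotopic.comp_both {A B C D : Type*} [TopologicalSpace A]
    [TopologicalSpace B] [TopologicalSpace C] [TopologicalSpace D] {f g : C(B, C)}
    (h : f.Homotopic g) (a : C(A, B)) (b : C(C, D)) :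
    (b.comp (f.comp a)).Homotopic (b.comp (g.comp a)) :=
  (ContinuousMap.Homotopic.refl b).comp (h.comp (ContinuousMap.Homotopic.refl a))

theorem IsPowerType.comp_equiv {k : ℕ} {f : C(Punctured V, Punctured W)} (hf : IsPowerType k f)
    (A : V' ≃L[ℝ] V) (B : W ≃L[ℝ] W') :
    IsPowerType k ((Punctured.ofEquiv B).comp (f.comp (Punctured.ofEquiv A))) := by
  obtain ⟨d, L, L', g, hg, hfg⟩ := hf
  refine ⟨d, A.trans L, L'.trans B, _, fun x => ?_, hfg.comp_both _ _⟩
  simp [hg]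

theorem IsPowerType.of_comp_equiv {k : ℕ} {f : C(Punctured V, Punctured W)} (A : V' ≃L[ℝ] V)
    (B : W ≃L[ℝ] W')
    (hf : IsPowerType k ((Punctured.ofEquiv B).comp (f.comp (Punctured.ofEquiv A)))) :
    IsPowerType k f := by
  have := hf.comp_equiv A.symm B.symm
  convert this using 1
  ext x
  simp [Punctured.ofEquiv, Punctured.map]

theorem isPowerType_zero (f : C(Punctured ℂ, Punctured ℂ)) : IsPowerType 0 f := by
  obtain ⟨d, c, g, hg, hfg⟩ := exists_homotopic_pow f
  let e : ℂ ≃L[ℝ] ℂ × (Fin 0 → ℝ) := (ContinuousLinearEquiv.prodUnique ℝ ℂ (Fin 0 → ℝ)).symm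
  exact ⟨d, c.trans e, e.symm, g, fun x => by simp [hg, e, suspendedPow], hfg⟩

theorem IsPowerType.suspension {k : ℕ} {f : C(Punctured (V × ℝ), Punctured (W × ℝ))}
    (hf : ∀ x, (f x : W × ℝ).1 = 0 → 0 < (x : V × ℝ).2 * (f x : W × ℝ).2)
    {g : C(Punctured V, Punctured W)}
    (hg : ∀ (v : Punctured V) (x : Punctured (V × ℝ)), (x : V × ℝ) = ((v : V), (0 : ℝ)) →
      (g v : W) = (f x : W × ℝ).1)
    (h : IsPowerType k g) : IsPowerType (k + 1) f := by
  obtain ⟨d, L, L', g', hg', hgg'⟩ := h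
  let e : ((ℂ × (Fin k → ℝ)) × ℝ) ≃L[ℝ] ℂ × (Fin (k + 1) → ℝ) :=
    (ContinuousLinearEquiv.prodAssoc ℝ ℂ (Fin k → ℝ) ℝ).trans
      ((ContinuousLinearEquiv.refl ℝ ℂ).prodCongr
        ((ContinuousLinearEquiv.prodComm ℝ (Fin k → ℝ) ℝ).trans
          (Fin.consEquivL ℝ (fun _ : Fin (k + 1) => ℝ))))
  have he : ∀ p t, suspendedPow d (k + 1) (e (p, t)) = e (suspendedPow d k p, t) := fun p t => rfl
  have hG : Continuous fun v => L' (suspendedPow d k (L v)) :=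
    L'.continuous.comp ((continuous_suspendedPow d k).comp L.continuous)
  have hG0 : ∀ v, v ≠ 0 → L' (suspendedPow d k (L v)) ≠ 0 := fun v hv => by
    simpa using suspendedPow_ne_zero d k (by simpa using hv)
  have hg'' : g' = Punctured.map _ hG hG0 := by
    ext x
    exact hg' x
  rw [hg''] at hgg'
  refine ⟨d, (L.prodCongr (ContinuousLinearEquiv.refl ℝ ℝ)).trans e,
    e.symm.trans (L'.prodCongr (ContinuousLinearEquiv.refl ℝ ℝ)),
    Punctured.map (fun x => (L' (suspendedPow d k (L x.1)), x.2)) 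
      ((hG.comp continuous_fst).prodMk continuous_snd) ?_, fun x => ?_,
    homotopic_suspension hf hg hG hG0 hgg' fun x => rfl⟩
  · intro x hx h
    refine hx (Prod.ext ?_ (show x.2 = 0 from congrArg Prod.snd h))
    by_contra h1
    exact hG0 x.1 h1 (congrArg Prod.fst h)
  · obtain ⟨⟨x, t⟩, hx⟩ := x
    show _ = (L'.prodCongr (ContinuousLinearEquiv.refl ℝ ℝ))
      (e.symm (suspendedPow d (k + 1) (e (L x, t))))
    rw [he, e.symm_apply_apply]
    rfl

theorem hasFDerivAt_suspendedPow (d k : ℕ) (p : ℂ × (Fin k → ℝ)) :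
    HasFDerivAt (suspendedPow d k) ((((d * p.1 ^ (d - 1) : ℂ) •
      (ContinuousLinearMap.id ℝ ℂ)).prodMap (ContinuousLinearMap.id ℝ (Fin k → ℝ)))) p := by
  have h := ((hasDerivAt_pow d p.1).complexToReal_fderiv)
  exact HasFDerivAt.prodMap p h (hasFDerivAt_id _)

theorem det_fderiv_suspendedPow (d k : ℕ) (p : ℂ × (Fin k → ℝ)) :
    (fderiv ℝ (suspendedPow d k) p).det = Complex.normSq (d * p.1 ^ (d - 1)) := by
  rw [(hasFDerivAt_suspendedPow d k p).fderiv, ← Algebra.norm_complex_apply, Algebra.norm_apply]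
  let m : ℂ →ₗ[ℝ] ℂ := LinearMap.mulLeft ℝ (d * p.1 ^ (d - 1))
  show LinearMap.det (m.prodMap (LinearMap.id : (Fin k → ℝ) →ₗ[ℝ] _)) = LinearMap.det m
  rw [LinearMap.det_prodMap, LinearMap.det_id, mul_one]

end NormalForm

section Antipode

theorem IsPowerType.exists_homotopic_const {ι : Type*} [Fintype ι] (hodd : Odd (Fintype.card ι))
    {k : ℕ} {f f' : C(Punctured (ι → ℝ), Punctured (ι → ℝ))} (hf : IsPowerType k f)
    (hneg : ∀ x, (f' x : ι → ℝ) = -f x) (h : f.Homotopic f') :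
    ∃ c, f.Homotopic (ContinuousMap.const _ c) := by
  obtain ⟨d, L, L', g, hg, hfg⟩ := hf
  rcases Nat.eq_zero_or_pos d with rfl | hd
  · have h1 : ∀ u : Fin k → ℝ, L' (1, u) ≠ 0 := fun u => by
      rw [map_ne_zero_iff L' L'.injective]
      exact fun h => one_ne_zero (congrArg Prod.fst h)
    refine ⟨⟨L' (1, 0), h1 0⟩, hfg.trans ?_⟩
    refine ⟨⟨⟨fun p => ⟨L' (1, (1 - (p.1 : ℝ)) • (L p.2).2), h1 _⟩, ?_⟩, fun x => ?_, fun x => ?_⟩⟩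
    · refine Continuous.subtype_mk (L'.continuous.comp (continuous_const.prodMk ?_)) _
      fun_prop
    · refine Subtype.ext ?_
      simp [hg, suspendedPow]
    · refine Subtype.ext ?_
      simp
  · exfalso
    let F : (ι → ℝ) → ι → ℝ := fun x => L' (suspendedPow d k (L x))
    let T : (ι → ℝ) ≃L[ℝ] (ι → ℝ) := L.trans L'
    let σ : ℝ := T.toContinuousLinearMap.det
    have hσ0 : σ ≠ 0 := (LinearEquiv.isUnit_det' T.toLinearEquiv).ne_zero
    have hpow : ContDiff ℝ 1 (suspendedPow d k) :=
      (contDiff_fst.pow d).prodMk contDiff_snd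
    have hF : ContDiff ℝ 1 F := L'.contDiff.comp (hpow.comp L.contDiff)
    have hdet : ∀ x, (fderiv ℝ F x).det = σ * Complex.normSq (d * (L x).1 ^ (d - 1)) := by
      intro x
      have hp : HasFDerivAt (suspendedPow d k) (fderiv ℝ (suspendedPow d k) (L x)) (L x) :=
        (hpow.differentiable one_ne_zero _).hasFDerivAt
      have e : HasFDerivAt F (L'.toContinuousLinearMap.comp
          ((fderiv ℝ (suspendedPow d k) (L x)).comp L.toContinuousLinearMap)) x :=
        L'.toContinuousLinearMap.hasFDerivAt.comp x
          (hp.comp x L.toContinuousLinearMap.hasFDerivAt)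
      rw [e.fderiv, ← det_fderiv_suspendedPow d k (L x)]
      let A : ℂ × (Fin k → ℝ) →ₗ[ℝ] ℂ × (Fin k → ℝ) :=
        (fderiv ℝ (suspendedPow d k) (L x)).toLinearMap
      show LinearMap.det _ = LinearMap.det T.toLinearEquiv.toLinearMap * LinearMap.det A
      rw [← LinearMap.det_conj A L.symm.toLinearEquiv, ← LinearMap.det_comp]
      congr 1
      ext y
      simp [A, T]
    refine not_homotopic_neg_of_det_sign hodd hF (σ := σ) (fun x => ?_) (fun ρ hρ => ?_) hg
      (g := ⟨fun x => ⟨-(g x : ι → ℝ), neg_ne_zero.2 (g x).2⟩, by fun_prop⟩)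
      (fun x => congrArg Neg.neg (hg x)) ?_
    · rw [hdet, ← mul_assoc]
      exact mul_nonneg (mul_self_nonneg σ) (Complex.normSq_nonneg _)
    · have hc : Continuous fun t : ℝ => L.symm ((t : ℂ), 0) := by fun_prop
      have hc' : Continuous fun t : ℝ => F (L.symm ((t : ℂ), 0)) := hF.continuous.comp hc
      have e1 : ∀ᶠ t : ℝ in 𝓝 0, ‖L.symm ((t : ℂ), (0 : Fin k → ℝ))‖ < 1 := by
        refine hc.norm.continuousAt.eventually_lt continuousAt_const ?_
        simp [← Prod.zero_eq_mk]
      have e2 : ∀ᶠ t : ℝ in 𝓝 0, ‖F (L.symm ((t : ℂ), (0 : Fin k → ℝ)))‖ < ρ := by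
        refine hc'.norm.continuousAt.eventually_lt continuousAt_const ?_
        have : suspendedPow d k 0 = 0 := Prod.ext (zero_pow hd.ne') rfl
        simpa [F, ← Prod.zero_eq_mk, this] using hρ
      obtain ⟨t, ⟨h1, h2⟩, ht⟩ := (((e1.and e2).filter_mono nhdsWithin_le_nhds).and
        (self_mem_nhdsWithin (s := Set.Ioi (0 : ℝ)))).exists
      refine ⟨_, h1, h2, ?_⟩
      rw [hdet]
      have ht0 : t ≠ 0 := ne_of_gt ht
      simp [hσ0, ht0, hd.ne']
    · refine (hfg.symm.trans h).trans ?_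
      obtain ⟨H⟩ := hfg
      exact ⟨{ toFun := fun p => ⟨-(H p : ι → ℝ), neg_ne_zero.2 (H p).2⟩
               continuous_toFun := by fun_prop
               map_zero_left := fun x => Subtype.ext (by simp [hneg])
               map_one_left := fun x => Subtype.ext (by simp) }⟩

end Antipode

section RegularValue

open Set MeasureTheory

theorem finite_fiber_of_det_ne_zero {E : Type*} [NormedAddCommGroup E] [NormedSpace ℝ E]
    [FiniteDimensional ℝ E] {G : E → E} {y : E} {K : Set E} (hK : IsCompact K)
    (hG : ∀ x ∈ K, DifferentiableAt ℝ G x) (hdet : ∀ x ∈ K, G x = y → (fderiv ℝ G x).det ≠ 0) :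
    {x ∈ K | G x = y}.Finite := by
  by_contra hinf
  obtain ⟨x, hxK, hx⟩ := Set.Infinite.exists_accPt_of_subset_isCompact hinf hK fun x hx => hx.1
  rw [accPt_iff_frequently_nhdsNE] at hx
  have hGx : G x = y := by
    by_contra hne
    have := ((hG x hxK).continuousAt.eventually_ne hne).filter_mono
      (nhdsWithin_le_nhds (s := {x}ᶜ))
    obtain ⟨z, hz, hz'⟩ := (hx.and_eventually this).exists
    exact hz' hz.2
  let e := (fderiv ℝ G x).toContinuousLinearEquivOfDetNeZero (hdet x hxK hGx)
  have := (hG x hxK).hasFDerivAt.eventually_ne (c := y) ⟨_, e.antilipschitz⟩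
  obtain ⟨z, hz, hz'⟩ := (hx.and_eventually this).exists
  exact hz' hz.2

variable {E : Type*} [NormedAddCommGroup E] [InnerProductSpace ℝ E] [FiniteDimensional ℝ E]

/-- Every map between punctured spaces is homotopic to a positively homogeneous one that takes a
pair of opposite values only finitely often. -/
theorem exists_homotopic_finite_fibers [Nontrivial E] (f : C(Punctured E, Punctured E)) :
    ∃ f' : C(Punctured E, Punctured E), f.Homotopic f' ∧
      (∀ (c : ℝ) (x x' : Punctured E), 0 < c → (x' : E) = c • (x : E) →
        (f' x' : E) = c • (f' x : E)) ∧
      ∃ y : E, y ≠ 0 ∧ {x | (f' x : E) = y}.Finite ∧ {x | (f' x : E) = -y}.Finite := by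
  obtain ⟨K, hK, hKn, hKc⟩ := exists_continuous_extension (X := Unit)
    (f.comp ⟨Prod.snd, continuous_snd⟩)
  obtain ⟨g, hg, hgd, -⟩ := Continuous.exists_contDiff_approx (f := fun x => K ((), x))
    (ε := fun _ => 1 / 2) 1 (by fun_prop) (by fun_prop) (fun _ => by norm_num)
  have hdist : ∀ u : E, ‖u‖ = 1 → ‖g u - K ((), u)‖ < 1 / 2 := fun u _ => by
    rw [← dist_eq_norm]
    exact hgd u
  have hgu : ∀ u : E, ‖u‖ = 1 → 1 / 2 ≤ ‖g u‖ ∧ ‖g u‖ ≤ 3 / 2 := by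
    intro u hu
    have h1 := hdist u hu
    have h2 := hKn () u
    have h3 := norm_sub_norm_le (K ((), u)) (g u)
    have h4 := norm_sub_norm_le (g u) (K ((), u))
    rw [norm_sub_rev] at h3
    constructor <;> linarith
  have hν1 : ∀ x : E, x ≠ 0 → ‖‖x‖⁻¹ • x‖ = 1 := fun x hx => by
    rw [norm_smul, norm_inv, norm_norm, inv_mul_cancel₀ (norm_ne_zero_iff.2 hx)]
  let G : E → E := fun x => ‖x‖ • g (‖x‖⁻¹ • x)
  have hGnorm : ∀ x, x ≠ 0 → ‖x‖ / 2 ≤ ‖G x‖ ∧ ‖G x‖ ≤ 3 * ‖x‖ / 2 := by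
    intro x hx
    obtain ⟨h1, h2⟩ := hgu _ (hν1 x hx)
    have h3 := norm_pos_iff.2 hx
    rw [norm_smul, norm_norm]
    constructor <;> nlinarith
  have hG0 : ∀ x, x ≠ 0 → G x ≠ 0 := fun x hx => norm_pos_iff.1 <| by
    have := (hGnorm x hx).1
    have h3 := norm_pos_iff.2 hx
    linarith
  have hGd : ∀ x, x ≠ 0 → DifferentiableAt ℝ G x := by
    intro x hx
    have h1 : DifferentiableAt ℝ (fun x : E => ‖x‖) x := differentiableAt_id.norm ℝ hx
    exact h1.smul ((hg.differentiable one_ne_zero _).comp x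
      ((h1.inv (norm_ne_zero_iff.2 hx)).smul differentiableAt_id))
  have hGc : Continuous fun x : Punctured E => G x := continuous_iff_continuousAt.2 fun x =>
    (hGd x x.2).continuousAt.comp continuous_subtype_val.continuousAt
  have hνc : Continuous fun x : Punctured E => ‖(x : E)‖⁻¹ • (x : E) :=
    ((continuous_norm.comp continuous_subtype_val).inv₀ fun x => norm_ne_zero_iff.2 x.2).smul
      continuous_subtype_val
  let ν : C(Punctured E, Punctured E) := ⟨fun x => ⟨‖(x : E)‖⁻¹ • (x : E),
    smul_ne_zero (inv_ne_zero (norm_ne_zero_iff.2 x.2)) x.2⟩, hνc.subtype_mk _⟩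
  let f₁ : C(Punctured E, Punctured E) := ⟨fun x => ⟨g (‖(x : E)‖⁻¹ • (x : E)), norm_pos_iff.1 <| by
    linarith [(hgu _ (hν1 x x.2)).1]⟩, (hg.continuous.comp hνc).subtype_mk _⟩
  let f' : C(Punctured E, Punctured E) := ⟨fun x => ⟨G x, hG0 x x.2⟩, hGc.subtype_mk _⟩
  have h1 : f.Homotopic (f.comp ν) := by
    have : (ContinuousMap.id (Punctured E)).Homotopic ν :=
      homotopic_of_pos_smul fun x => ⟨_, inv_pos.2 (norm_pos_iff.2 x.2), rfl⟩
    exact (ContinuousMap.Homotopic.refl f).comp this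
  have h2 : (f.comp ν).Homotopic f₁ := by
    refine homotopic_of_segment_ne_zero fun x a b ha hb hab h0 => ?_
    obtain ⟨c, hc, e⟩ := hKc () (ν x)
    have hu := hν1 x x.2
    have hKu : ‖K ((), (ν x : E))‖ = 1 := (hKn _ _).trans hu
    have hd : ‖g (ν x) - K ((), (ν x : E))‖ < 1 / 2 := hdist _ hu
    have h0' : a • (f (ν x) : E) + b • g (ν x) = 0 := h0
    have e' : K ((), (ν x : E)) = c • (f (ν x) : E) := e
    have e2 : (a + b * c) • K ((), (ν x : E)) = -(b * c) • (g (ν x) - K ((), (ν x : E))) := by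
      have : (a + b * c) • K ((), (ν x : E)) + (b * c) • (g (ν x) - K ((), (ν x : E))) =
          c • (a • (f (ν x) : E) + b • g (ν x)) := by
        rw [e']
        module
      rw [h0', smul_zero] at this
      rw [neg_smul]
      exact eq_neg_of_add_eq_zero_left this
    have e3 := congrArg norm e2
    rw [norm_smul, norm_smul, hKu, norm_neg, Real.norm_eq_abs, Real.norm_eq_abs,
      abs_of_nonneg (by positivity), abs_of_nonneg (by positivity)] at e3
    rcases ha.eq_or_lt with rfl | ha
    · have hb1 : b = 1 := by linarith
      subst hb1
      nlinarith
    · nlinarith [mul_nonneg hb hc.le]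
  have h3 : f₁.Homotopic f' := homotopic_of_pos_smul fun x => ⟨_, norm_pos_iff.2 x.2, rfl⟩
  refine ⟨f', (h1.trans h2).trans h3, ?_, ?_⟩
  · intro c x x' hc hx
    show G x' = c • G x
    simp only [G, hx, norm_smul, Real.norm_eq_abs, abs_of_pos hc, mul_inv, smul_smul]
    congr 3
    field_simp
  · borelize E
    let S : Set E := {x | x ≠ 0 ∧ (fderiv ℝ G x).det = 0}
    let μ : Measure E := volume
    have hS : μ (G '' S) = 0 := addHaar_image_eq_zero_of_det_fderivWithin_eq_zero μ
      (fun x hx => (hGd x hx.1).hasFDerivAt.hasFDerivWithinAt) fun x hx => hx.2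
    have hS' : μ (-(G '' S)) = 0 := by rw [measure_neg_null, hS]
    have hall : μ (({0} ∪ G '' S) ∪ -(G '' S)) = 0 :=
      measure_union_null (measure_union_null (measure_singleton 0) hS) hS'
    obtain ⟨y, hy⟩ : ∃ y, y ∉ ({0} ∪ G '' S) ∪ -(G '' S) := by
      by_contra! h
      rw [eq_univ_of_forall h] at hall
      exact (isOpen_univ.measure_ne_zero μ univ_nonempty) hall
    simp only [mem_union, mem_singleton_iff, Set.mem_neg, not_or] at hy
    have key : ∀ z : E, ‖z‖ = ‖y‖ → z ∉ G '' S → {x | (f' x : E) = z}.Finite := by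
      intro z hz hzS
      have hy0 : 0 < ‖y‖ := norm_pos_iff.2 hy.1.1
      let A : Set E := Metric.closedBall 0 (2 * ‖y‖) ∩ {x | ‖y‖ / 2 ≤ ‖x‖}
      have hA : IsCompact A := (isCompact_closedBall 0 _).inter_right
        (isClosed_le continuous_const continuous_norm)
      have hA0 : ∀ x ∈ A, x ≠ 0 := fun x hx => norm_pos_iff.1 <| by
        have : ‖y‖ / 2 ≤ ‖x‖ := hx.2
        linarith
      have hfin := finite_fiber_of_det_ne_zero hA (fun x hx => hGd x (hA0 x hx))
        (y := z) fun x hx hxz h0 => hzS ⟨x, ⟨hA0 x hx, h0⟩, hxz⟩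
      refine (hfin.preimage (f := ((↑) : Punctured E → E)) Subtype.val_injective.injOn).subset ?_
      intro x hx
      have hx' : G x = z := hx
      obtain ⟨h1, h2⟩ := hGnorm x x.2
      rw [hx', hz] at h1 h2
      refine ⟨⟨?_, ?_⟩, hx'⟩
      · rw [mem_closedBall_zero_iff]
        linarith
      · rw [mem_ofPred_eq]
        linarith
    refine ⟨y, hy.1.1, key y rfl hy.1.2, key (-y) (norm_neg y) hy.2⟩

end RegularValue

section Shear

open Set

theorem exists_notMem_span_pair {E : Type*} [AddCommGroup E] [Module ℝ E] [FiniteDimensional ℝ E]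
    (hE : 3 ≤ Module.finrank ℝ E) {S : Set E} (hS : S.Finite) :
    ∃ e : E, e ≠ 0 ∧ ∀ p ∈ S, ∀ q ∈ S, e ∉ Submodule.span ℝ {p, q} := by
  classical
  have : Finite S := hS
  let T : Option (S × S) → Submodule ℝ E := fun i =>
    i.elim ⊥ fun i => Submodule.span ℝ {(i.1 : E), (i.2 : E)}
  have hT : ∀ i, T i ≠ ⊤ := by
    intro i hi
    have h1 : Module.finrank ℝ (T i) ≤ 2 := by
      rcases i with _ | ⟨p, q⟩
      · show Module.finrank ℝ (⊥ : Submodule ℝ E) ≤ 2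
        simp
      · refine (finrank_span_le_card (R := ℝ) ({(p : E), (q : E)} : Set E)).trans ?_
        rw [Set.toFinset_insert, Set.toFinset_singleton]
        exact Finset.card_le_two
    rw [hi, finrank_top] at h1
    omega
  have hU : ⋃ i, (T i : Set E) ≠ univ := fun h => by
    obtain ⟨i, hi⟩ := Subspace.exists_eq_top_of_iUnion_eq_univ h
    exact hT i hi
  obtain ⟨e, he⟩ := (ne_univ_iff_exists_notMem _).1 hU
  simp only [mem_iUnion, not_exists] at he
  exact ⟨e, fun h0 => he none (by simp [h0]), fun p hp q hq => he (some (⟨p, hp⟩, ⟨q, hq⟩))⟩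

variable {V : Type*} [NormedAddCommGroup V] [NormedSpace ℝ V]
variable {W : Type*} [NormedAddCommGroup W] [NormedSpace ℝ W]

/-- A continuous positively homogeneous function that is very negative on one finite set of
directions and very positive on another. -/
theorem exists_homogeneous_separation {P Q : Set V} (hP : P.Finite) (hQ : Q.Finite)
    (hP0 : ∀ p ∈ P, p ≠ 0) (hQ0 : ∀ q ∈ Q, q ≠ 0)
    (hPQ : ∀ p ∈ P, ∀ q ∈ Q, ‖p‖⁻¹ • p ≠ ‖q‖⁻¹ • q) (C : ℝ) :
    ∃ h : V → ℝ, Continuous h ∧ (∀ (c : ℝ) x, 0 < c → h (c • x) = c * h x) ∧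
      (∀ p ∈ P, h p < -C) ∧ ∀ q ∈ Q, C < h q := by
  let ν : V → V := fun v => ‖v‖⁻¹ • v
  obtain ⟨η, hη0, hη1, hη⟩ := exists_continuous_zero_one_of_isClosed
    (hP.image ν).isClosed (hQ.image ν).isClosed (by
      rw [Set.disjoint_left]
      rintro _ ⟨p, hp, rfl⟩ ⟨q, hq, h⟩
      exact hPQ p hp q hq h.symm)
  have hνc : ContinuousOn ν {v | ‖v‖ ≠ 0} :=
    (continuousOn_id.norm.inv₀ fun v hv => hv).smul continuousOn_id
  have hκ : Continuous fun v => ‖v‖ • (2 * η (ν v) - 1) := by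
    refine continuous_smul_of_norm_le_one continuous_norm ?_ fun v => ?_
    · exact (((map_continuous η).comp_continuousOn hνc).const_mul 2).sub continuousOn_const
    · rw [Real.norm_eq_abs, abs_le]
      constructor <;> linarith [(hη (ν v)).1, (hη (ν v)).2]
  obtain ⟨M, hM⟩ := ((hP.union hQ).image fun v => C / ‖v‖).bddAbove
  have hM' : ∀ v ∈ P ∪ Q, v ≠ 0 → C < (M + 1) * ‖v‖ := fun v hv hv0 => by
    have h1 := hM (mem_image_of_mem _ hv)
    have h2 := norm_pos_iff.2 hv0
    rw [div_le_iff₀ h2] at h1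
    linarith
  refine ⟨fun v => (M + 1) * (‖v‖ • (2 * η (ν v) - 1)), by fun_prop, ?_, ?_, ?_⟩
  · intro c x hc
    have : ν (c • x) = ν x := by
      simp only [ν, norm_smul, Real.norm_eq_abs, abs_of_pos hc, mul_inv, smul_smul]
      congr 1
      field_simp
    simp only [this, norm_smul, Real.norm_eq_abs, abs_of_pos hc, smul_eq_mul]
    ring
  · intro p hp
    have e : η (ν p) = 0 := hη0 (mem_image_of_mem ν hp)
    have := hM' p (Or.inl hp) (hP0 p hp)
    simp only [e, smul_eq_mul]
    linarith
  · intro q hq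
    have e : η (ν q) = 1 := hη1 (mem_image_of_mem ν hq)
    have := hM' q (Or.inr hq) (hQ0 q hq)
    simp only [e, smul_eq_mul]
    linarith

/-- A homogeneous map that takes the two poles finitely often can be sheared so that the preimages
of the poles lie in the corresponding open half spaces. -/
theorem exists_homotopic_sheared {f : C(Punctured (V × ℝ), Punctured (W × ℝ))}
    (hhom : ∀ (c : ℝ) (x x' : Punctured (V × ℝ)), 0 < c → (x' : V × ℝ) = c • (x : V × ℝ) →
      (f x' : W × ℝ) = c • (f x : W × ℝ))
    {P Q : Set (Punctured (V × ℝ))} (hP : P.Finite) (hQ : Q.Finite)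
    (hfP : ∀ x, x ∈ P ↔ (f x : W × ℝ) = (0, 1)) (hfQ : ∀ x, x ∈ Q ↔ (f x : W × ℝ) = -(0, 1))
    (hspan : ∀ p ∈ P ∪ Q, ∀ q ∈ P ∪ Q,
      ((0 : V), (1 : ℝ)) ∉ Submodule.span ℝ {(p : V × ℝ), (q : V × ℝ)}) :
    ∃ f' : C(Punctured (V × ℝ), Punctured (W × ℝ)), f.Homotopic f' ∧
      ∀ x, (f' x : W × ℝ).1 = 0 → 0 < (x : V × ℝ).2 * (f' x : W × ℝ).2 := by
  have hpole : ∀ p ∈ P ∪ Q, ∀ q ∈ P ∪ Q, ∀ a b : ℝ,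
      a • (p : V × ℝ).1 + b • (q : V × ℝ).1 = 0 →
        a * (p : V × ℝ).2 + b * (q : V × ℝ).2 = 0 := by
    intro p hp q hq a b hab
    by_contra hne
    refine hspan p hp q hq (Submodule.mem_span_pair.2
      ⟨(a * (p : V × ℝ).2 + b * (q : V × ℝ).2)⁻¹ * a,
        (a * (p : V × ℝ).2 + b * (q : V × ℝ).2)⁻¹ * b, Prod.ext ?_ ?_⟩)
    · simp only [Prod.fst_add, Prod.smul_fst, mul_smul, ← smul_add, hab, smul_zero]
    · simp only [Prod.snd_add, Prod.smul_snd, smul_eq_mul, mul_assoc, ← mul_add]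
      exact inv_mul_cancel₀ hne
  have h10 : ∀ p ∈ P ∪ Q, (p : V × ℝ).1 ≠ 0 := fun p hp h0 => by
    have := hpole p hp p hp 1 0 (by simp [h0])
    exact p.2 (Prod.ext h0 (by simpa using this))
  have hdir : ∀ p ∈ P, ∀ q ∈ Q, ‖(p : V × ℝ).1‖⁻¹ • (p : V × ℝ).1 ≠
      ‖(q : V × ℝ).1‖⁻¹ • (q : V × ℝ).1 := by
    intro p hp q hq h
    have h1 := norm_pos_iff.2 (h10 p (Or.inl hp))
    have h2 := norm_pos_iff.2 (h10 q (Or.inr hq))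
    have h3 := hpole p (Or.inl hp) q (Or.inr hq) ‖(p : V × ℝ).1‖⁻¹ (-‖(q : V × ℝ).1‖⁻¹)
      (by rw [h, neg_smul, add_neg_cancel])
    have e : (p : V × ℝ) = (‖(p : V × ℝ).1‖ * ‖(q : V × ℝ).1‖⁻¹) • (q : V × ℝ) := by
      refine Prod.ext ?_ ?_
      · rw [Prod.smul_fst, mul_smul, ← h, smul_smul, mul_inv_cancel₀ h1.ne', one_smul]
      · rw [Prod.smul_snd, smul_eq_mul]
        field_simp at h3 ⊢
        linarith
    have e2 := congrArg Prod.snd (hhom _ q p (by positivity) e)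
    rw [(hfP p).1 hp, (hfQ q).1 hq] at e2
    have : 0 < ‖(p : V × ℝ).1‖ * ‖(q : V × ℝ).1‖⁻¹ := by positivity
    simp only [Prod.smul_snd, Prod.snd_neg, smul_eq_mul] at e2
    linarith
  obtain ⟨C, hC⟩ := ((hP.union hQ).image fun p : Punctured (V × ℝ) => |(p : V × ℝ).2|).bddAbove
  obtain ⟨h, hhc, hhs, hhP, hhQ⟩ := exists_homogeneous_separation
    (hP.image fun p : Punctured (V × ℝ) => (p : V × ℝ).1)
    (hQ.image fun p : Punctured (V × ℝ) => (p : V × ℝ).1)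
    (by rintro _ ⟨p, hp, rfl⟩; exact h10 p (Or.inl hp))
    (by rintro _ ⟨p, hp, rfl⟩; exact h10 p (Or.inr hp))
    (by rintro _ ⟨p, hp, rfl⟩ _ ⟨q, hq, rfl⟩; exact hdir p hp q hq) C
  have hh0 : h 0 = 0 := by
    have := hhs 2 0 two_pos
    rw [smul_zero] at this
    linarith
  have hshear : ∀ (b : ℝ) (x : V × ℝ), x ≠ 0 → (x.1, x.2 + b * h x.1) ≠ 0 := by
    intro b x hx h0
    have h1 : x.1 = 0 := congrArg Prod.fst h0
    have h2 : x.2 + b * h x.1 = 0 := congrArg Prod.snd h0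
    rw [h1, hh0, mul_zero, add_zero] at h2
    exact hx (Prod.ext h1 h2)
  let φ : C(Punctured (V × ℝ), Punctured (V × ℝ)) :=
    Punctured.map (fun x => (x.1, x.2 + 1 * h x.1)) (by fun_prop) (hshear 1)
  have hφ : (ContinuousMap.id (Punctured (V × ℝ))).Homotopic φ := by
    refine homotopic_of_segment_ne_zero fun x a b _ _ hab => ?_
    convert hshear b x x.2 using 1
    refine Prod.ext ?_ ?_
    · show a • (x : V × ℝ).1 + b • (x : V × ℝ).1 = _
      rw [← add_smul, hab, one_smul]
    · show a * (x : V × ℝ).2 + b * ((x : V × ℝ).2 + 1 * h (x : V × ℝ).1) = _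
      linear_combination (x : V × ℝ).2 * hab
  refine ⟨f.comp φ, (ContinuousMap.Homotopic.refl f).comp hφ, fun x hx => ?_⟩
  have hx1 : (f (φ x) : W × ℝ).1 = 0 := hx
  show 0 < (x : V × ℝ).2 * (f (φ x) : W × ℝ).2
  set s : ℝ := (f (φ x) : W × ℝ).2 with hs
  have hs0 : s ≠ 0 := fun h0 => (f (φ x)).2 (Prod.ext hx1 h0)
  have hc : 0 < |s|⁻¹ := inv_pos.2 (abs_pos.2 hs0)
  let z : Punctured (V × ℝ) := ⟨|s|⁻¹ • (φ x : V × ℝ), smul_ne_zero hc.ne' (φ x).2⟩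
  have hfz : (f z : W × ℝ) = (0, |s|⁻¹ * s) := by
    rw [hhom _ (φ x) z hc rfl]
    exact Prod.ext (by simp [hx1]) rfl
  have hz1 : (z : V × ℝ).1 = |s|⁻¹ • (x : V × ℝ).1 := rfl
  have hz2 : (z : V × ℝ).2 = |s|⁻¹ * ((x : V × ℝ).2 + 1 * h (x : V × ℝ).1) := rfl
  have hhz : h (z : V × ℝ).1 = |s|⁻¹ * h (x : V × ℝ).1 := by rw [hz1, hhs _ _ hc]
  have hkey : |s|⁻¹ * (x : V × ℝ).2 = (z : V × ℝ).2 - h (z : V × ℝ).1 := by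
    rw [hz2, hhz]
    ring
  rcases lt_or_gt_of_ne hs0 with hneg | hpos
  · have hzQ : z ∈ Q := (hfQ z).2 <| by
      rw [hfz, abs_of_neg hneg, inv_neg, neg_mul, inv_mul_cancel₀ hs0]
      simp
    have h1 := hhQ _ (mem_image_of_mem _ hzQ)
    have h2 := (abs_le.1 (hC (mem_image_of_mem _ (Or.inr hzQ)))).2
    have h3 : |s|⁻¹ * (x : V × ℝ).2 < 0 := by linarith
    exact mul_pos_of_neg_of_neg (by by_contra! h; nlinarith) hneg
  · have hzP : z ∈ P := (hfP z).2 <| by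
      rw [hfz, abs_of_pos hpos, inv_mul_cancel₀ hs0]
    have h1 := hhP _ (mem_image_of_mem _ hzP)
    have h2 := (abs_le.1 (hC (mem_image_of_mem _ (Or.inl hzP)))).1
    have h3 : 0 < |s|⁻¹ * (x : V × ℝ).2 := by linarith
    exact mul_pos (by by_contra! h; nlinarith) hpos

end Shear

section Classification

open Set

theorem IsPowerType.succ {E W : Type*} [NormedAddCommGroup E] [InnerProductSpace ℝ E]
    [FiniteDimensional ℝ E] [NormedAddCommGroup W] [NormedSpace ℝ W] [FiniteDimensional ℝ W]
    {k : ℕ} (hW : Module.finrank ℝ W = k + 2) (hE : Module.finrank ℝ E = k + 3)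
    (h : ∀ g : C(Punctured W, Punctured W), IsPowerType k g) (f : C(Punctured E, Punctured E)) :
    IsPowerType (k + 1) f := by
  have : Nontrivial E := Module.nontrivial_of_finrank_pos (R := ℝ) (by omega)
  obtain ⟨f', hff', hhom, y, hy, hP, hQ⟩ := exists_homotopic_finite_fibers f
  refine IsPowerType.of_homotopic ?_ hff'
  obtain ⟨e, he, hspan⟩ := exists_notMem_span_pair (E := E) (by omega)
    ((hP.union hQ).image fun x : Punctured E => (x : E))
  let A₀ : E ≃L[ℝ] W × ℝ := ContinuousLinearEquiv.ofFinrankEq (by simp [hW, hE])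
  have hne : ∀ v, v ≠ 0 → A₀ v ≠ 0 := fun v hv => (map_ne_zero_iff A₀ A₀.injective).2 hv
  have h01 : ((0 : W), (1 : ℝ)) ≠ 0 := fun h => one_ne_zero (congrArg Prod.snd h)
  obtain ⟨T, hT⟩ := SeparatingDual.exists_continuousLinearEquiv_apply_eq (R := ℝ) (hne e he) h01
  obtain ⟨T', hT'⟩ := SeparatingDual.exists_continuousLinearEquiv_apply_eq (R := ℝ) (hne y hy) h01
  let A := A₀.trans T
  let A' := A₀.trans T'
  have hA : A.symm (0, 1) = e := by rw [A.symm_apply_eq]; exact hT.symm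
  have hA' : A' y = (0, 1) := hT'
  refine IsPowerType.of_comp_equiv A.symm A' ?_
  have hinj : Function.Injective (Punctured.ofEquiv A.symm) := fun a b hab =>
    Subtype.ext (A.symm.injective (congrArg Subtype.val hab))
  obtain ⟨f₁, hf₁, hhalf⟩ := exists_homotopic_sheared
    (f := (Punctured.ofEquiv A').comp (f'.comp (Punctured.ofEquiv A.symm)))
    (P := Punctured.ofEquiv A.symm ⁻¹' {x | (f' x : E) = y})
    (Q := Punctured.ofEquiv A.symm ⁻¹' {x | (f' x : E) = -y})
    (fun c x x' hc hx => by
      have := hhom c (Punctured.ofEquiv A.symm x) (Punctured.ofEquiv A.symm x') hc (by simp [hx])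
      simp [this])
    (hP.preimage hinj.injOn) (hQ.preimage hinj.injOn)
    (fun x => by
      rw [← hA']
      exact A'.injective.eq_iff.symm)
    (fun x => by
      rw [← hA', ← map_neg]
      exact A'.injective.eq_iff.symm)
    (fun p hp q hq hmem => by
      refine hspan _ (mem_image_of_mem _ hp) _ (mem_image_of_mem _ hq) ?_
      rw [← hA]
      have := Submodule.mem_map_of_mem (f := A.symm.toLinearEquiv.toLinearMap) hmem
      rw [Submodule.map_span, image_pair] at this
      exact this)
  refine IsPowerType.of_homotopic ?_ hf₁
  let i : C(Punctured W, Punctured (W × ℝ)) :=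
    Punctured.map (fun w => (w, 0)) (by fun_prop) fun w hw h0 => hw (congrArg Prod.fst h0)
  let g : C(Punctured W, Punctured W) := ⟨fun w => ⟨(f₁ (i w) : W × ℝ).1, fun h0 => by
    have h1 : (0 : ℝ) < 0 * (f₁ (i w) : W × ℝ).2 := hhalf (i w) h0
    rw [zero_mul] at h1
    exact lt_irrefl _ h1⟩, by fun_prop⟩
  refine IsPowerType.suspension hhalf (g := g) (fun v x hx => ?_) (h g)
  have : x = i v := Subtype.ext hx
  rw [this]
  rfl

theorem isPowerType_euclideanSpace (k : ℕ) :
    ∀ f : C(Punctured (EuclideanSpace ℝ (Fin (k + 2))), Punctured (EuclideanSpace ℝ (Fin (k + 2)))),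
      IsPowerType k f := by
  induction k with
  | zero =>
    intro f
    let A : ℂ ≃L[ℝ] EuclideanSpace ℝ (Fin (0 + 2)) := ContinuousLinearEquiv.ofFinrankEq (by simp)
    exact IsPowerType.of_comp_equiv A A.symm (isPowerType_zero _)
  | succ k ih => exact fun f => IsPowerType.succ (by simp) (by simp) ih f

theorem exists_homotopic_const_of_homotopic_neg {k : ℕ} (hodd : Odd (k + 2))
    {f f' : C(Punctured (EuclideanSpace ℝ (Fin (k + 2))),
      Punctured (EuclideanSpace ℝ (Fin (k + 2))))}
    (hneg : ∀ x, (f' x : EuclideanSpace ℝ (Fin (k + 2))) = -f x) (h : f.Homotopic f') :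
    ∃ c, f.Homotopic (ContinuousMap.const _ c) := by
  let A := EuclideanSpace.equiv (Fin (k + 2)) ℝ
  let a := Punctured.ofEquiv A
  let b := Punctured.ofEquiv A.symm
  have hba : b.comp a = ContinuousMap.id _ := by
    ext1 x
    exact Subtype.ext (A.symm_apply_apply x)
  have hcancel : ∀ u : C(Punctured (EuclideanSpace ℝ (Fin (k + 2))),
      Punctured (EuclideanSpace ℝ (Fin (k + 2)))), b.comp ((a.comp (u.comp b)).comp a) = u := by
    intro u
    calc _ = (b.comp a).comp (u.comp (b.comp a)) := rfl
      _ = u := by rw [hba, ContinuousMap.comp_id, ContinuousMap.id_comp]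
  obtain ⟨c, hc⟩ := IsPowerType.exists_homotopic_const (ι := Fin (k + 2)) (by simpa using hodd)
    ((isPowerType_euclideanSpace k f).comp_equiv A.symm A) (f' := a.comp (f'.comp b))
    (fun x => by
      show A (f' (b x)) = -A (f (b x))
      rw [hneg, map_neg]) (h.comp_both b a)
  refine ⟨b c, ?_⟩
  have := hc.comp_both a b
  rwa [hcancel] at this

end Classification

section Sphere

theorem exists_homotopic_const_of_loose {n : ℕ} (hn : 2 ≤ n) (hne : Even n)
    {f : C(UnitSphere n, UnitSphere n)} (h : Loose f f) :
    ∃ y : UnitSphere n, f.Homotopic (ContinuousMap.const _ y) := by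
  obtain ⟨k, rfl⟩ : ∃ k, n = k + 1 := ⟨n - 1, by omega⟩
  obtain ⟨f₁, f₂, h₁, h₂, hdis⟩ := h
  have hunit : ∀ x : UnitSphere (k + 1), ‖(x : EuclideanSpace ℝ (Fin (k + 2)))‖ = 1 := fun x =>
    mem_sphere_zero_iff_norm.1 x.2
  let i : C(UnitSphere (k + 1), Punctured (EuclideanSpace ℝ (Fin (k + 2)))) :=
    ⟨fun x => ⟨x, ne_zero_of_mem_unit_sphere x⟩, by fun_prop⟩
  have hνc : Continuous fun x : Punctured (EuclideanSpace ℝ (Fin (k + 2))) =>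
      ‖(x : EuclideanSpace ℝ (Fin (k + 2)))‖⁻¹ • (x : EuclideanSpace ℝ (Fin (k + 2))) :=
    ((continuous_norm.comp continuous_subtype_val).inv₀ fun x => norm_ne_zero_iff.2 x.2).smul
      continuous_subtype_val
  have hν1 : ∀ x : Punctured (EuclideanSpace ℝ (Fin (k + 2))),
      ‖(x : EuclideanSpace ℝ (Fin (k + 2)))‖⁻¹ • (x : EuclideanSpace ℝ (Fin (k + 2))) ∈
        Metric.sphere (0 : EuclideanSpace ℝ (Fin (k + 2))) 1 := fun x => by
    rw [mem_sphere_zero_iff_norm, norm_smul, norm_inv, norm_norm,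
      inv_mul_cancel₀ (norm_ne_zero_iff.2 x.2)]
  let r : C(Punctured (EuclideanSpace ℝ (Fin (k + 2))), UnitSphere (k + 1)) :=
    ⟨fun x => ⟨‖(x : EuclideanSpace ℝ (Fin (k + 2)))‖⁻¹ • (x : EuclideanSpace ℝ (Fin (k + 2))),
      hν1 x⟩, hνc.subtype_mk hν1⟩
  have hri : r.comp i = ContinuousMap.id _ := by
    ext1 x
    refine Subtype.ext ?_
    show ‖(x : EuclideanSpace ℝ (Fin (k + 2)))‖⁻¹ • (x : EuclideanSpace ℝ (Fin (k + 2))) = x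
    rw [hunit, inv_one, one_smul]
  have hcancel : ∀ u : C(UnitSphere (k + 1), UnitSphere (k + 1)),
      r.comp ((i.comp (u.comp r)).comp i) = u := by
    intro u
    calc _ = (r.comp i).comp (u.comp (r.comp i)) := rfl
      _ = u := by rw [hri, ContinuousMap.comp_id, ContinuousMap.id_comp]
  let N : C(UnitSphere (k + 1), UnitSphere (k + 1)) := ⟨fun x => -x, continuous_neg⟩
  have hN : (i.comp (f₁.comp r)).Homotopic (i.comp ((N.comp f₂).comp r)) := by
    refine homotopic_of_segment_ne_zero fun x a b ha hb hab h0 => hdis (r x) ?_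
    have h0' : a • (f₁ (r x) : EuclideanSpace ℝ (Fin (k + 2))) +
        b • -(f₂ (r x) : EuclideanSpace ℝ (Fin (k + 2))) = 0 := h0
    rw [smul_neg, ← sub_eq_add_neg, sub_eq_zero] at h0'
    have hn' := congrArg norm h0'
    rw [norm_smul, norm_smul, hunit, hunit, Real.norm_eq_abs, Real.norm_eq_abs, abs_of_nonneg ha,
      abs_of_nonneg hb, mul_one, mul_one] at hn'
    rw [← hn'] at h0'
    exact Subtype.ext (smul_right_injective _ (show a ≠ 0 by intro h; linarith) h0')
  have hNf : (i.comp ((N.comp f₂).comp r)).Homotopic (i.comp ((N.comp f).comp r)) :=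
    h₂.comp_both r (i.comp N)
  obtain ⟨c, hc⟩ := exists_homotopic_const_of_homotopic_neg (k := k) (hne.add_one)
    (f := i.comp (f.comp r)) (f' := i.comp ((N.comp f).comp r)) (fun x => rfl)
    (((h₁.symm.comp_both r i).trans hN).trans hNf)
  refine ⟨r c, ?_⟩
  have := hc.comp_both i r
  rwa [hcancel] at this

theorem loose_of_homotopic_const {n : ℕ} (hn : 1 ≤ n) {f : C(UnitSphere n, UnitSphere n)}
    {y : UnitSphere n} (h : f.Homotopic (ContinuousMap.const _ y)) : Loose f f := by
  have hrank : 1 < Module.rank ℝ (EuclideanSpace ℝ (Fin (n + 1))) := by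
    rw [← Module.finrank_eq_rank, finrank_euclideanSpace_fin]
    exact_mod_cast Nat.lt_succ_of_le hn
  have : PathConnectedSpace (UnitSphere n) :=
    isPathConnected_iff_pathConnectedSpace.1 (isPathConnected_sphere hrank 0 zero_le_one)
  have hy : (ContinuousMap.const (UnitSphere n) y).Homotopic (ContinuousMap.const _ (-y)) :=
    ContinuousMap.homotopic_const_iff.2 (PathConnectedSpace.joined y (-y))
  exact ⟨_, _, h.symm, (h.trans hy).symm, fun _ => ne_neg_of_mem_unit_sphere ℝ y⟩

end Sphere

/-- For `n ≥ 2` even and a continuous map `f : Sⁿ → Sⁿ`, the pair `(f, f)` is loose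
if and only if `f` is nullhomotopic. -/
theorem statement11 (n : ℕ) (hn : 2 ≤ n) (hne : Even n)
    (f : C(UnitSphere n, UnitSphere n)) :
    Loose f f ↔ ∃ y : UnitSphere n, f.Homotopic (ContinuousMap.const _ y) := by
  exact ⟨exists_homotopic_const_of_loose hn hne,
    fun ⟨_, h⟩ => loose_of_homotopic_const (by omega) h⟩
end
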